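/- arXiv:1003.5286 — 2 statements merged into one kernel-verified Lean document; each statement's English description precedes it below -/
import Mathlib

section
/- There exists an absolute constant C > 0 with the following property: for every σ > 0, every bounded continuous function f : ℝ² → ℂ whose Fourier transform (in the distributional sense) is supported in the closed disc {ξ ∈ ℝ² : |ξ| ≤ σ}, all bounded normal operators N₁, N₂ on a complex Hilbert space H, and every bounded operator Q on H, one has ‖f(N₁)Q − Q f(N₂)‖ ≤ C · σ · ‖f‖_{L∞} · max{ ‖N₁Q − QN₂‖, ‖N₁*Q − QN₂*‖ }. -/
open MeasureTheory Filter
open scoped FourierTransform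

/-- Fourier transform of `f` (as a tempered distribution, identifying `ℝ²` with `ℂ`)
is supported in the closed disc of radius `σ` centered at the origin. -/
def FourierSupportedIn (f : ℂ → ℂ) (σ : ℝ) : Prop :=
  ∀ φ : SchwartzMap ℂ ℂ, Disjoint (tsupport ⇑φ) (Metric.closedBall (0 : ℂ) σ) →
    ∫ x : ℂ, f x * 𝓕 (⇑φ) x = 0

section Reproducing

open scoped SchwartzMap

theorem SchwartzMap.fourier_mul_eq_integral (κ ψ : 𝓢(ℂ, ℂ)) (z : ℂ) :
    𝓕 (fun v ↦ κ v * 𝓕⁻ ψ v) z = ∫ y, ψ y * 𝓕 κ (z - y) := by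
  have key := VectorFourier.integral_bilin_fourierIntegral_eq_flip (ContinuousLinearMap.mul ℂ ℂ)
    (μ := volume) (ν := volume) (L := -innerₗ ℂ) (f := ψ)
    (g := fun v ↦ Real.fourierChar (-inner ℝ v z) • κ v)
    Real.continuous_fourierChar (continuous_inner (𝕜 := ℝ) (E := ℂ)).neg ψ.integrable
    ((Real.fourierIntegral_convergent_iff z).2 κ.integrable)
  have h1 : ∀ v, VectorFourier.fourierIntegral Real.fourierChar volume (-innerₗ ℂ) ψ v
      = 𝓕⁻ ψ v := by
    intro v
    rw [SchwartzMap.fourierInv_coe, Real.fourierInv_eq]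
    simp [VectorFourier.fourierIntegral]
  have h2 : ∀ y, VectorFourier.fourierIntegral Real.fourierChar volume (-innerₗ ℂ).flip
      (fun v ↦ Real.fourierChar (-inner ℝ v z) • κ v) y = 𝓕 κ (z - y) := by
    intro y
    rw [SchwartzMap.fourier_coe, Real.fourier_eq]
    simp only [VectorFourier.fourierIntegral]
    refine integral_congr_ae (.of_forall fun v ↦ ?_)
    simp only [smul_smul, ← AddChar.map_add_eq_mul]
    congr 2
    simp [inner_sub_right, real_inner_comm]
    ring
  simp only [h1, h2, ContinuousLinearMap.mul_apply'] at key
  rw [← key, Real.fourier_eq]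
  refine integral_congr_ae (.of_forall fun v ↦ ?_)
  simp only [Circle.smul_def, smul_eq_mul]
  ring

theorem FourierSupportedIn.eq_integral {f : BoundedContinuousFunction ℂ ℂ} {σ r : ℝ}
    (hf : FourierSupportedIn f σ) (hr : σ < r) (κ : 𝓢(ℂ, ℂ))
    (hκ : ∀ ξ ∈ Metric.ball (0 : ℂ) r, κ ξ = 1) (y : ℂ) :
    f y = ∫ z, f z * 𝓕 κ (z - y) := by
  have hcont : Continuous fun y ↦ ∫ z, f z * 𝓕 κ (z - y) := by
    have : (fun y ↦ ∫ z, f z * 𝓕 κ (z - y)) = fun y ↦ ∫ z, f (z + y) * 𝓕 κ z := by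
      ext y
      rw [← integral_add_right_eq_self _ y]
      simp
    rw [this]
    refine continuous_of_dominated (bound := fun z ↦ ‖f‖ * ‖𝓕 κ z‖) ?_ ?_ ?_ ?_
    · intro y
      exact (by fun_prop : Continuous fun z ↦ f (z + y) * 𝓕 κ z).aestronglyMeasurable
    · intro y
      refine .of_forall fun z ↦ ?_
      rw [norm_mul]
      gcongr
      exact f.norm_coe_le_norm _
    · exact (𝓕 κ).integrable.norm.const_mul _
    · exact .of_forall fun z ↦ by fun_prop
  refine congrFun (Continuous.ae_eq_iff_eq volume f.continuous hcont |>.1 ?_) y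
  refine ae_eq_of_integral_contDiff_smul_eq f.continuous.locallyIntegrable
    hcont.locallyIntegrable fun g hg hgc ↦ ?_
  have hψs : HasCompactSupport fun x ↦ (g x : ℂ) := hgc.comp_left Complex.ofReal_zero
  let ψ : 𝓢(ℂ, ℂ) := hψs.toSchwartzMap (Complex.ofRealCLM.contDiff.comp hg)
  have hψ : ∀ x, ψ x = g x := fun x ↦ rfl
  let χ : 𝓢(ℂ, ℂ) := 𝓕⁻ ψ - SchwartzMap.pairing (ContinuousLinearMap.mul ℂ ℂ) κ (𝓕⁻ ψ)
  have hχ : ∀ v, χ v = 𝓕⁻ ψ v - κ v * 𝓕⁻ ψ v := fun v ↦ by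
    simp [χ, SchwartzMap.pairing_apply_apply]
  have hdisj : Disjoint (tsupport χ) (Metric.closedBall (0 : ℂ) σ) := by
    have : tsupport χ ⊆ (Metric.ball (0 : ℂ) r)ᶜ := by
      refine closure_minimal (fun v hv hvr ↦ hv ?_) Metric.isOpen_ball.isClosed_compl
      rw [hχ, hκ v hvr]
      ring
    exact (disjoint_compl_left.mono_right (Metric.closedBall_subset_ball hr)).mono_left this
  have h0 := hf χ hdisj
  have h𝓕 : ∀ z, 𝓕 (⇑χ) z = ψ z - ∫ y, ψ y * 𝓕 κ (z - y) := by
    intro z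
    have e1 : 𝓕 (⇑χ) z = 𝓕 (𝓕⁻ ψ) z
        - 𝓕 (SchwartzMap.pairing (ContinuousLinearMap.mul ℂ ℂ) κ (𝓕⁻ ψ)) z := by
      rw [← SchwartzMap.fourier_coe]
      exact congrArg (fun g : 𝓢(ℂ, ℂ) ↦ g z)
        (map_sub (FourierTransform.fourierCLM ℂ 𝓢(ℂ, ℂ)) (𝓕⁻ ψ) _)
    rw [e1, FourierTransform.fourier_fourierInv_eq, ← SchwartzMap.fourier_mul_eq_integral]
    rfl
  have hint : Integrable (Function.uncurry fun z y ↦ f z * (ψ y * 𝓕 κ (z - y)))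
      (volume.prod volume) := by
    have h1 : Integrable (fun p : ℂ × ℂ ↦ ψ p.2 * 𝓕 κ (p.1 - p.2)) (volume.prod volume) :=
      ψ.integrable.convolution_integrand (.mul ℂ ℂ) (𝓕 κ).integrable
    refine h1.bdd_mul (c := ‖f‖) ?_ (.of_forall fun p ↦ f.norm_coe_le_norm _)
    exact (f.continuous.comp continuous_fst).aestronglyMeasurable
  have hfψ : Integrable fun z ↦ f z * ψ z :=
    ψ.integrable.bdd_mul f.continuous.aestronglyMeasurable
      (.of_forall fun p ↦ f.norm_coe_le_norm _)
  have h2 : ∫ z, f z * ψ z = ∫ z, ∫ y, f z * (ψ y * 𝓕 κ (z - y)) := by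
    have hi : Integrable fun z ↦ ∫ y, f z * (ψ y * 𝓕 κ (z - y)) := hint.integral_prod_left
    rw [← sub_eq_zero, ← integral_sub hfψ hi, ← h0]
    refine integral_congr_ae (.of_forall fun z ↦ ?_)
    simp only [h𝓕, mul_sub, integral_const_mul]
  rw [integral_integral_swap hint] at h2
  simp only [Complex.real_smul, ← hψ]
  calc ∫ x, ψ x * f x = ∫ z, f z * ψ z := by simp only [mul_comm]
    _ = _ := h2
    _ = _ := by
      refine integral_congr_ae (.of_forall fun y ↦ ?_)
      simp only [← integral_const_mul]
      refine integral_congr_ae (.of_forall fun z ↦ ?_)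
      simp only
      ring

end Reproducing

section OperatorExponential

open Real

theorem norm_exp_mul_sub_mul_exp_le {A : Type*} [NormedRing A] [NormedAlgebra ℝ A]
    [CompleteSpace A] {X Y : A} (hX : ∀ t : ℝ, ‖NormedSpace.exp (t • X)‖ ≤ 1)
    (hY : ∀ t : ℝ, ‖NormedSpace.exp (t • Y)‖ ≤ 1) (R : A) :
    ‖NormedSpace.exp X * R - R * NormedSpace.exp Y‖ ≤ ‖X * R - R * Y‖ := by
  have hderiv : ∀ t : ℝ, HasDerivAt
      (fun t : ℝ ↦ NormedSpace.exp (t • X) * R * NormedSpace.exp ((1 - t) • Y))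
      (NormedSpace.exp (t • X) * (X * R - R * Y) * NormedSpace.exp ((1 - t) • Y)) t := by
    intro t
    have h1 := (hasDerivAt_exp_smul_const X t).mul_const R
    have h2 := (hasDerivAt_exp_smul_const' Y (1 - t)).scomp t ((hasDerivAt_id t).const_sub 1)
    convert! h1.mul h2 using 1
    simp only [Function.comp_apply, neg_smul, one_smul]
    noncomm_ring
  have := (convex_univ (𝕜 := ℝ)).norm_image_sub_le_of_norm_hasDerivWithin_le
    (fun t _ ↦ (hderiv t).hasDerivWithinAt) (C := ‖X * R - R * Y‖) (fun t _ ↦ ?_)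
    (Set.mem_univ 0) (Set.mem_univ 1)
  · simpa using this
  · calc _ ≤ ‖NormedSpace.exp (t • X)‖ * ‖X * R - R * Y‖ * ‖NormedSpace.exp ((1 - t) • Y)‖ :=
        norm_mul₃_le
      _ ≤ 1 * ‖X * R - R * Y‖ * 1 := by
        gcongr
        exacts [hX t, hY _]
      _ = _ := by ring

variable {A : Type*} [CStarAlgebra A]

/-- The operator `exp (2 π i ⟪v, N⟫)` attached to a frequency `v` and a normal element `N`. -/
noncomputable def cfcChar (N : A) (v : ℂ) : A := cfc (fun y : ℂ ↦ (𝐞 (inner ℝ v y) : ℂ)) N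

/-- The element `2 π i ⟪v, N⟫`. -/
noncomputable def cfcCharExponent (N : A) (v : ℂ) : A :=
  (π * Complex.I * star v) • N + (π * Complex.I * v) • star N

theorem cfcChar_eq_exp {N : A} (hN : IsStarNormal N) (v : ℂ) :
    cfcChar N v = NormedSpace.exp (cfcCharExponent N v) := by
  have hX : cfcCharExponent N v =
      cfc (fun y : ℂ ↦ (π * Complex.I * star v) * y + (π * Complex.I * v) * star y) N := by
    rw [cfc_add (a := N) (fun y : ℂ ↦ (π * Complex.I * star v) * y)
      (fun y ↦ (π * Complex.I * v) * star y), cfc_const_mul _ (fun y : ℂ ↦ y) N,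
      cfc_const_mul _ (fun y : ℂ ↦ star y) N, cfc_star, cfc_id' ℂ N]
    rfl
  have hn : IsStarNormal (cfcCharExponent N v) := hX ▸ cfc_predicate _ N
  rw [← CFC.complex_exp_eq_normedSpace_exp hn, hX, ← cfc_comp' Complex.exp _ N, cfcChar]
  refine cfc_congr fun y _ ↦ ?_
  simp only [fourierChar_apply]
  congr 1
  rw [Complex.inner]
  apply Complex.ext <;> simp
  ring

theorem norm_cfcChar_le (N : A) (v : ℂ) : ‖cfcChar N v‖ ≤ 1 :=
  norm_cfc_le zero_le_one fun _ _ ↦ (Circle.norm_coe _).le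

theorem cfcCharExponent_smul (N : A) (t : ℝ) (v : ℂ) :
    cfcCharExponent N (t • v) = t • cfcCharExponent N v := by
  simp only [cfcCharExponent, smul_add, ← smul_assoc]
  congr 2 <;> simp <;> ring

theorem contDiff_cfcChar {N : A} (hN : IsStarNormal N) : ContDiff ℝ ⊤ (cfcChar N) := by
  have h : cfcChar N = fun v ↦ NormedSpace.exp (cfcCharExponent N v) :=
    funext fun v ↦ cfcChar_eq_exp hN v
  rw [h]
  refine ContDiff.comp (g := NormedSpace.exp) (contDiff_iff_contDiffAt.2 fun x ↦
    (NormedSpace.exp_analytic (𝕂 := ℝ) x).contDiffAt) ?_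
  have hstar : ContDiff ℝ ⊤ (fun v : ℂ ↦ star v) := Complex.conjCLE.contDiff
  unfold cfcCharExponent
  fun_prop

theorem norm_cfcChar_mul_sub_mul_cfcChar_le {N₁ N₂ : A} (h₁ : IsStarNormal N₁)
    (h₂ : IsStarNormal N₂) (R : A) (v : ℂ) :
    ‖cfcChar N₁ v * R - R * cfcChar N₂ v‖ ≤
      2 * π * ‖v‖ * max ‖N₁ * R - R * N₂‖ ‖star N₁ * R - R * star N₂‖ := by
  have h : ∀ {N : A}, IsStarNormal N → ∀ t : ℝ,
      ‖NormedSpace.exp (t • cfcCharExponent N v)‖ ≤ 1 := fun hN t ↦ by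
    rw [← cfcCharExponent_smul, ← cfcChar_eq_exp hN]
    exact norm_cfcChar_le _ _
  rw [cfcChar_eq_exp h₁, cfcChar_eq_exp h₂]
  refine (norm_exp_mul_sub_mul_exp_le (h h₁) (h h₂) R).trans ?_
  have e : cfcCharExponent N₁ v * R - R * cfcCharExponent N₂ v =
      (π * Complex.I * star v) • (N₁ * R - R * N₂)
        + (π * Complex.I * v) • (star N₁ * R - R * star N₂) := by
    simp only [cfcCharExponent, add_mul, mul_add, smul_mul_assoc, mul_smul_comm, smul_sub]
    abel
  rw [e]
  refine (norm_add_le _ _).trans ?_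
  rw [norm_smul, norm_smul]
  have hn1 : ‖(π * Complex.I * star v : ℂ)‖ = π * ‖v‖ := by simp [pi_pos.le]
  have hn2 : ‖(π * Complex.I * v : ℂ)‖ = π * ‖v‖ := by simp [pi_pos.le]
  rw [hn1, hn2]
  calc _ ≤ π * ‖v‖ * max ‖N₁ * R - R * N₂‖ ‖star N₁ * R - R * star N₂‖
        + π * ‖v‖ * max ‖N₁ * R - R * N₂‖ ‖star N₁ * R - R * star N₂‖ := by
        gcongr
        exacts [le_max_left _ _, le_max_right _ _]
    _ = _ := by ring

open scoped SchwartzMap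

theorem cfc_fourier_sub (a : 𝓢(ℂ, ℂ)) {N : A} (hN : IsStarNormal N) (z : ℂ) :
    cfc (fun y ↦ 𝓕 a (z - y)) N = 𝓕 (fun v ↦ a v • cfcChar N v) z := by
  have h1 : (fun y ↦ 𝓕 a (z - y)) =
      fun y ↦ ∫ v, (𝐞 (-inner ℝ v z) : ℂ) * a v * (𝐞 (inner ℝ v y) : ℂ) := by
    ext y
    rw [SchwartzMap.fourier_coe, Real.fourier_eq]
    refine integral_congr_ae (.of_forall fun v ↦ ?_)
    simp only [Circle.smul_def, smul_eq_mul, inner_sub_right, neg_sub]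
    rw [sub_eq_neg_add, AddChar.map_add_eq_mul, Circle.coe_mul]
    ring
  have hchar : Continuous fun t : ℝ ↦ (𝐞 t : ℂ) :=
    continuous_subtype_val.comp continuous_fourierChar
  rw [h1, cfc_integral _ (fun v ↦ ‖a v‖) N ?_
    (.of_forall fun v y _ ↦ by simp only [norm_mul, Circle.norm_coe, one_mul, mul_one, le_refl])
    a.integrable.norm.hasFiniteIntegral, Real.fourier_eq]
  · refine integral_congr_ae (.of_forall fun v ↦ ?_)
    simp only
    rw [cfc_const_mul _ _ N (by fun_prop), Circle.smul_def, smul_smul]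
    rfl
  · refine Continuous.continuousOn ?_
    simp only [Function.uncurry_def]
    have := a.continuous
    fun_prop

theorem integrable_smul_cfcChar (a : 𝓢(ℂ, ℂ)) {N : A} (hN : IsStarNormal N) :
    Integrable fun v ↦ a v • cfcChar N v :=
  a.integrable.norm.mono' (a.continuous.smul (contDiff_cfcChar hN).continuous).aestronglyMeasurable
    (.of_forall fun v ↦ by
      rw [norm_smul]
      exact mul_le_of_le_one_right (norm_nonneg _) (norm_cfcChar_le N v))

end OperatorExponential

section SquareFunction

open Real
open scoped SchwartzMap

theorem integral_mul_le_sqrt_mul_sqrt {X : Type*} [MeasurableSpace X] {μ : Measure X}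
    {u v : X → ℝ} (hu : MemLp u 2 μ) (hv : MemLp v 2 μ) (hu0 : 0 ≤ u) (hv0 : 0 ≤ v) :
    ∫ x, u x * v x ∂μ ≤ √(∫ x, u x ^ 2 ∂μ) * √(∫ x, v x ^ 2 ∂μ) := by
  have := integral_mul_le_Lp_mul_Lq_of_nonneg (μ := μ) (p := 2) (q := 2)
    (by rw [Real.holderConjugate_iff]; norm_num) (.of_forall hu0) (.of_forall hv0)
    (by simpa using hu) (by simpa using hv)
  simpa [Real.sqrt_eq_rpow] using this

theorem exists_integrable_bound_translates (φ : 𝓢(ℂ, ℂ)) (r : ℝ) (hr : 0 ≤ r) :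
    ∃ g : ℂ → ℝ, Integrable g ∧ ∀ z y : ℂ, ‖y‖ ≤ r → ‖φ (z - y)‖ ≤ g z := by
  obtain ⟨C, hC⟩ : ∃ C, ∀ x : ℂ, (1 + ‖x‖) ^ 3 * ‖φ x‖ ≤ C := by
    have := SchwartzMap.one_add_le_sup_seminorm_apply (𝕜 := ℝ) (m := (3, 0)) (k := 3) (n := 0)
      le_rfl le_rfl φ
    simp only [norm_iteratedFDeriv_zero] at this
    exact ⟨_, this⟩
  have hC0 : 0 ≤ C := le_trans (by positivity) (hC 0)
  refine ⟨fun z ↦ (C * (1 + r) ^ 3) * (1 + ‖z‖) ^ (-(3 : ℝ)), ?_, fun z y hy ↦ ?_⟩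
  · refine Integrable.const_mul (integrable_one_add_norm ?_) _
    simp only [Complex.finrank_real_complex]
    norm_num
  · have h1 : 1 + ‖z‖ ≤ (1 + r) * (1 + ‖z - y‖) := by
      have := norm_add_le (z - y) y
      rw [sub_add_cancel] at this
      nlinarith [norm_nonneg (z - y)]
    simp only
    rw [rpow_neg (by positivity), ← div_eq_mul_inv, le_div_iff₀ (by positivity)]
    calc ‖φ (z - y)‖ * (1 + ‖z‖) ^ (3 : ℝ) = ‖φ (z - y)‖ * (1 + ‖z‖) ^ 3 := by norm_cast
      _ ≤ ‖φ (z - y)‖ * ((1 + r) * (1 + ‖z - y‖)) ^ 3 := by gcongr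
      _ = ((1 + ‖z - y‖) ^ 3 * ‖φ (z - y)‖) * (1 + r) ^ 3 := by ring
      _ ≤ C * (1 + r) ^ 3 := by gcongr; exact hC _

section Plancherel

variable {F : Type*} [NormedAddCommGroup F] [InnerProductSpace ℂ F]
  {a : 𝓢(ℂ, ℂ)} {G : ℂ → F}

theorem exists_schwartzMap_eq_smul (ha : HasCompactSupport a) (hG : ContDiff ℝ ⊤ G) :
    ∃ g : 𝓢(ℂ, F), ⇑g = fun v ↦ a v • G v :=
  ⟨HasCompactSupport.toSchwartzMap (f := fun v ↦ a v • G v) ha.smul_right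
    ((a.smooth _).smul (hG.of_le le_top)), rfl⟩

theorem memLp_norm_fourier_smul (ha : HasCompactSupport a) (hG : ContDiff ℝ ⊤ G) :
    MemLp (fun z ↦ ‖𝓕 (fun v ↦ a v • G v) z‖) 2 := by
  obtain ⟨g, hg⟩ := exists_schwartzMap_eq_smul ha hG
  rw [← hg, ← SchwartzMap.fourier_coe]
  exact ((𝓕 g).memLp 2).norm

theorem integral_norm_fourier_smul_sq_le [CompleteSpace F] (ha : HasCompactSupport a)
    (hG : ContDiff ℝ ⊤ G) {w : ℂ → ℝ} (hw : Continuous w) (hGw : ∀ v, ‖G v‖ ≤ w v) :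
    ∫ z, ‖𝓕 (fun v ↦ a v • G v) z‖ ^ 2 ≤ ∫ v, ‖a v‖ ^ 2 * w v ^ 2 := by
  obtain ⟨g, hg⟩ := exists_schwartzMap_eq_smul ha hG
  rw [← hg, ← SchwartzMap.fourier_coe, SchwartzMap.integral_norm_sq_fourier]
  refine integral_mono_of_nonneg (.of_forall fun v ↦ by positivity) ?_ (.of_forall fun v ↦ ?_)
  · refine Continuous.integrable_of_hasCompactSupport (by have := a.continuous; fun_prop) ?_
    exact (ha.comp_left (g := fun x ↦ ‖x‖ ^ 2) (by simp)).mul_right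
  · simp only [hg, norm_smul, mul_pow]
    gcongr
    exact hGw v

end Plancherel

theorem fourier_clm_apply {E F : Type*} [NormedAddCommGroup E] [NormedSpace ℂ E] [CompleteSpace E]
    [NormedAddCommGroup F] [NormedSpace ℂ F] [CompleteSpace F] (L : E →L[ℂ] F) {g : ℂ → E}
    (hg : Integrable g) (z : ℂ) : 𝓕 (fun v ↦ L (g v)) z = L (𝓕 g z) := by
  rw [Real.fourier_eq, Real.fourier_eq,
    ← L.integral_comp_comm ((Real.fourierIntegral_convergent_iff z).2 hg)]
  simp [Circle.smul_def]

theorem contDiff_clm_apply_complex {H : Type*} [NormedAddCommGroup H] [NormedSpace ℂ H]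
    {E : ℂ → H →L[ℂ] H} (hE : ContDiff ℝ ⊤ E) (h : H) :
    ContDiff ℝ ⊤ fun v ↦ E v h :=
  ((ContinuousLinearMap.apply ℂ H h).restrictScalars ℝ).contDiff.comp hE

variable {H : Type*} [NormedAddCommGroup H] [InnerProductSpace ℂ H] [CompleteSpace H]

/-- The operator `𝓕 a (z - N)`, for a normal operator `N`. -/
noncomputable def smear (a : 𝓢(ℂ, ℂ)) (N : H →L[ℂ] H) (z : ℂ) : H →L[ℂ] H :=
  cfc (fun y ↦ 𝓕 a (z - y)) N

theorem smear_apply (a : 𝓢(ℂ, ℂ)) {N : H →L[ℂ] H} (hN : IsStarNormal N) (z : ℂ) (h : H) :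
    smear a N z h = 𝓕 (fun v ↦ a v • cfcChar N v h) z := by
  rw [smear, cfc_fourier_sub a hN]
  exact (fourier_clm_apply (ContinuousLinearMap.apply ℂ H h) (integrable_smul_cfcChar a hN) z).symm

theorem smear_commutator_apply (a : 𝓢(ℂ, ℂ)) {N₁ N₂ : H →L[ℂ] H} (h₁ : IsStarNormal N₁)
    (h₂ : IsStarNormal N₂) (R : H →L[ℂ] H) (z : ℂ) (h : H) :
    (smear a N₁ z * R - R * smear a N₂ z) h =
      𝓕 (fun v ↦ a v • (cfcChar N₁ v * R - R * cfcChar N₂ v) h) z := by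
  have i₁ := integrable_smul_cfcChar a h₁
  have i₂ := integrable_smul_cfcChar a h₂
  have e := fourier_clm_apply (R ∘L ContinuousLinearMap.apply ℂ H h) i₂ z
  have j₁ := (ContinuousLinearMap.apply ℂ H (R h)).integrable_comp i₁
  have j₂ := (R ∘L ContinuousLinearMap.apply ℂ H h).integrable_comp i₂
  simp only [ContinuousLinearMap.comp_apply, ContinuousLinearMap.apply_apply] at e j₁ j₂
  rw [sub_apply, mul_apply_eq_comp, mul_apply_eq_comp,
    smear_apply a h₁, smear, cfc_fourier_sub a h₂, ← e, Real.fourier_eq, Real.fourier_eq,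
    Real.fourier_eq, ← integral_sub]
  · refine integral_congr_ae (.of_forall fun v ↦ ?_)
    simp [← smul_sub]
  · exact (Real.fourierIntegral_convergent_iff z).2 j₁
  · exact (Real.fourierIntegral_convergent_iff z).2 j₂

section SmearBounds

variable {a : 𝓢(ℂ, ℂ)} {N N₁ N₂ : H →L[ℂ] H}

theorem memLp_norm_smear_apply (ha : HasCompactSupport a) (hN : IsStarNormal N) (h : H) :
    MemLp (fun z ↦ ‖smear a N z h‖) 2 := by
  simp only [smear_apply a hN]
  exact memLp_norm_fourier_smul ha (contDiff_clm_apply_complex (contDiff_cfcChar hN) h)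

theorem sqrt_integral_norm_smear_apply_sq_le (ha : HasCompactSupport a) (hN : IsStarNormal N)
    (h : H) : √(∫ z, ‖smear a N z h‖ ^ 2) ≤ √(∫ v, ‖a v‖ ^ 2) * ‖h‖ := by
  rw [← Real.sqrt_sq (norm_nonneg h), ← Real.sqrt_mul (by positivity),
    ← integral_mul_const]
  simp only [smear_apply a hN]
  refine Real.sqrt_le_sqrt (integral_norm_fourier_smul_sq_le ha
    (contDiff_clm_apply_complex (contDiff_cfcChar hN) h) continuous_const fun v ↦ ?_)
  exact (ContinuousLinearMap.le_opNorm _ _).trans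
    (mul_le_of_le_one_left (norm_nonneg _) (norm_cfcChar_le N v))

theorem contDiff_cfcChar_commutator (h₁ : IsStarNormal N₁) (h₂ : IsStarNormal N₂)
    (R : H →L[ℂ] H) : ContDiff ℝ ⊤ fun v ↦ cfcChar N₁ v * R - R * cfcChar N₂ v :=
  ((contDiff_cfcChar h₁).mul contDiff_const).sub (contDiff_const.mul (contDiff_cfcChar h₂))

theorem memLp_norm_smear_commutator_apply (ha : HasCompactSupport a) (h₁ : IsStarNormal N₁)
    (h₂ : IsStarNormal N₂) (R : H →L[ℂ] H) (h : H) :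
    MemLp (fun z ↦ ‖(smear a N₁ z * R - R * smear a N₂ z) h‖) 2 := by
  simp only [smear_commutator_apply a h₁ h₂]
  exact memLp_norm_fourier_smul ha
    (contDiff_clm_apply_complex (contDiff_cfcChar_commutator h₁ h₂ R) h)

theorem sqrt_integral_norm_smear_commutator_apply_sq_le (ha : HasCompactSupport a)
    (h₁ : IsStarNormal N₁) (h₂ : IsStarNormal N₂) (R : H →L[ℂ] H) (h : H) :
    √(∫ z, ‖(smear a N₁ z * R - R * smear a N₂ z) h‖ ^ 2) ≤
      √(∫ v, ‖a v‖ ^ 2 * ‖v‖ ^ 2) *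
        (2 * π * max ‖N₁ * R - R * N₂‖ ‖star N₁ * R - R * star N₂‖ * ‖h‖) := by
  set δ := max ‖N₁ * R - R * N₂‖ ‖star N₁ * R - R * star N₂‖ with hδ
  have hδ0 : 0 ≤ δ := le_max_of_le_left (norm_nonneg _)
  set K := 2 * π * δ * ‖h‖ with hK
  have hK0 : 0 ≤ K := by positivity
  have e : (∫ v, ‖a v‖ ^ 2 * ‖v‖ ^ 2) * K ^ 2 = ∫ v, ‖a v‖ ^ 2 * (‖v‖ * K) ^ 2 := by
    simp only [mul_pow, ← mul_assoc, integral_mul_const]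
  rw [← Real.sqrt_sq hK0, ← Real.sqrt_mul (by positivity), e]
  simp only [smear_commutator_apply a h₁ h₂]
  refine Real.sqrt_le_sqrt (integral_norm_fourier_smul_sq_le ha
    (contDiff_clm_apply_complex (contDiff_cfcChar_commutator h₁ h₂ R) h) (by fun_prop) fun v ↦ ?_)
  refine (ContinuousLinearMap.le_opNorm _ _).trans ?_
  calc _ ≤ (2 * π * ‖v‖ * δ) * ‖h‖ := by
        gcongr
        exact norm_cfcChar_mul_sub_mul_cfcChar_le h₁ h₂ R v
    _ = _ := by ring

end SmearBounds

theorem cfc_mul_fourier_sub (f : BoundedContinuousFunction ℂ ℂ) {a b κ : 𝓢(ℂ, ℂ)}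
    (hκ : ∀ z, 𝓕 κ z = 𝓕 a z * 𝓕 b z) (N : H →L[ℂ] H) (z : ℂ) :
    cfc (fun y ↦ f z * 𝓕 κ (z - y)) N = f z • (smear a N z * smear b N z) := by
  rw [cfc_const_mul (f z) (fun y ↦ 𝓕 κ (z - y)) N (by fun_prop), smear, smear,
    ← cfc_mul (fun y ↦ 𝓕 a (z - y)) (fun y ↦ 𝓕 b (z - y)) N (by fun_prop) (by fun_prop)]
  simp only [hκ]

theorem exists_integrable_bound_mul_fourier_sub (f : BoundedContinuousFunction ℂ ℂ)
    (κ : 𝓢(ℂ, ℂ)) (N : H →L[ℂ] H) :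
    ∃ g : ℂ → ℝ, Integrable g ∧ ∀ z, ∀ y ∈ spectrum ℂ N, ‖f z * 𝓕 κ (z - y)‖ ≤ g z := by
  obtain ⟨g, hg, hgb⟩ :=
    exists_integrable_bound_translates (𝓕 κ) (‖N‖ * ‖(1 : H →L[ℂ] H)‖) (by positivity)
  refine ⟨fun z ↦ ‖f‖ * g z, hg.const_mul _, fun z y hy ↦ ?_⟩
  simp only [norm_mul]
  gcongr
  · exact f.norm_coe_le_norm z
  · exact hgb z y (spectrum.norm_le_norm_mul_of_mem hy)

theorem integrable_smul_smear_mul_smear (f : BoundedContinuousFunction ℂ ℂ) {a b κ : 𝓢(ℂ, ℂ)}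
    (hκ : ∀ z, 𝓕 κ z = 𝓕 a z * 𝓕 b z) {N : H →L[ℂ] H} (hN : IsStarNormal N) :
    Integrable fun z ↦ f z • (smear a N z * smear b N z) := by
  obtain ⟨g, hg, hgb⟩ := exists_integrable_bound_mul_fourier_sub f κ N
  simp only [← cfc_mul_fourier_sub f hκ]
  refine integrable_cfc _ g N ?_ (.of_forall hgb) hg.hasFiniteIntegral
  simp only [Function.uncurry_def]
  fun_prop

theorem cfc_eq_integral_smear (f : BoundedContinuousFunction ℂ ℂ) {a b κ : 𝓢(ℂ, ℂ)}
    (hκ : ∀ z, 𝓕 κ z = 𝓕 a z * 𝓕 b z) (hf : ∀ y, f y = ∫ z, f z * 𝓕 κ (z - y))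
    {N : H →L[ℂ] H} (hN : IsStarNormal N) :
    cfc f N = ∫ z, f z • (smear a N z * smear b N z) := by
  obtain ⟨g, hg, hgb⟩ := exists_integrable_bound_mul_fourier_sub f κ N
  simp only [← cfc_mul_fourier_sub f hκ]
  rw [← cfc_integral _ g N ?_ (.of_forall hgb) hg.hasFiniteIntegral]
  · exact cfc_congr fun y _ ↦ hf y
  · simp only [Function.uncurry_def]
    fun_prop

theorem star_smear {a : 𝓢(ℂ, ℂ)} (ha : ∀ z, star (𝓕 a z) = 𝓕 a z) (N : H →L[ℂ] H) (z : ℂ) :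
    star (smear a N z) = smear a N z := by
  rw [smear, ← cfc_star]
  simp only [ha]

theorem norm_inner_smear_commutator_le {a : 𝓢(ℂ, ℂ)} (ha : ∀ z, star (𝓕 a z) = 𝓕 a z)
    (b : 𝓢(ℂ, ℂ)) (N₁ N₂ Q : H →L[ℂ] H) (z : ℂ) (h g : H) :
    ‖inner ℂ g ((smear a N₁ z * smear b N₁ z * Q - Q * (smear a N₂ z * smear b N₂ z)) h)‖ ≤
      ‖smear a N₁ z g‖ * ‖(smear b N₁ z * Q - Q * smear b N₂ z) h‖
        + ‖(smear a N₂ z * star Q - star Q * smear a N₁ z) g‖ * ‖smear b N₂ z h‖ := by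
  have e : smear a N₁ z * smear b N₁ z * Q - Q * (smear a N₂ z * smear b N₂ z) =
      star (smear a N₁ z) * (smear b N₁ z * Q - Q * smear b N₂ z)
        - star (smear a N₂ z * star Q - star Q * smear a N₁ z) * smear b N₂ z := by
    simp only [star_sub, star_mul, star_star, star_smear ha]
    noncomm_ring
  rw [e, sub_apply, inner_sub_right, mul_apply_eq_comp, mul_apply_eq_comp,
    ContinuousLinearMap.star_eq_adjoint, ContinuousLinearMap.star_eq_adjoint,
    ContinuousLinearMap.adjoint_inner_right, ContinuousLinearMap.adjoint_inner_right]
  exact (norm_sub_le _ _).trans (add_le_add (norm_inner_le_norm _ _) (norm_inner_le_norm _ _))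

theorem norm_cfc_mul_sub_mul_cfc_le (f : BoundedContinuousFunction ℂ ℂ) {a b κ : 𝓢(ℂ, ℂ)}
    (ha : HasCompactSupport a) (hb : HasCompactSupport b)
    (ha' : ∀ z, star (𝓕 a z) = 𝓕 a z) (hκ : ∀ z, 𝓕 κ z = 𝓕 a z * 𝓕 b z)
    (hf : ∀ y, f y = ∫ z, f z * 𝓕 κ (z - y)) {N₁ N₂ : H →L[ℂ] H} (h₁ : IsStarNormal N₁)
    (h₂ : IsStarNormal N₂) (Q : H →L[ℂ] H) :
    ‖cfc f N₁ * Q - Q * cfc f N₂‖ ≤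
      2 * π * (√(∫ v, ‖a v‖ ^ 2) * √(∫ v, ‖b v‖ ^ 2 * ‖v‖ ^ 2)
        + √(∫ v, ‖a v‖ ^ 2 * ‖v‖ ^ 2) * √(∫ v, ‖b v‖ ^ 2))
      * ‖f‖ * max ‖N₁ * Q - Q * N₂‖ ‖star N₁ * Q - Q * star N₂‖ := by
  set δ := max ‖N₁ * Q - Q * N₂‖ ‖star N₁ * Q - Q * star N₂‖ with hδ
  have hδ0 : 0 ≤ δ := le_max_of_le_left (norm_nonneg _)
  have hδ' : max ‖N₂ * star Q - star Q * N₁‖ ‖star N₂ * star Q - star Q * star N₁‖ = δ := by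
    rw [hδ, max_comm, ← norm_star (N₁ * Q - Q * N₂), ← norm_star (star N₁ * Q - Q * star N₂)]
    simp only [star_sub, star_mul, star_star]
    rw [norm_sub_rev (star N₂ * star Q), norm_sub_rev (N₂ * star Q)]
  have i₁ := integrable_smul_smear_mul_smear f hκ h₁
  have i₂ := integrable_smul_smear_mul_smear f hκ h₂
  have hT : cfc f N₁ * Q - Q * cfc f N₂ =
      ∫ z, f z • (smear a N₁ z * smear b N₁ z * Q - Q * (smear a N₂ z * smear b N₂ z)) := by
    rw [cfc_eq_integral_smear f hκ hf h₁, cfc_eq_integral_smear f hκ hf h₂,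
      ← integral_mul_const_of_integrable i₁, ← integral_const_mul_of_integrable i₂,
      ← integral_sub (i₁.mul_const Q) (i₂.const_mul Q)]
    simp only [smul_mul_assoc, mul_smul_comm, smul_sub]
  have iT : Integrable fun z ↦
      f z • (smear a N₁ z * smear b N₁ z * Q - Q * (smear a N₂ z * smear b N₂ z)) := by
    refine ((i₁.mul_const Q).sub (i₂.const_mul Q)).congr (.of_forall fun z ↦ ?_)
    simp only [smul_mul_assoc, mul_smul_comm, smul_sub, Pi.sub_apply]
  refine ContinuousLinearMap.opNorm_le_of_re_inner_le (by positivity) fun h g hh hg ↦ ?_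
  let L : (H →L[ℂ] H) →L[ℂ] ℂ := innerSL ℂ g ∘L ContinuousLinearMap.apply ℂ H h
  have mem_a := memLp_norm_smear_apply ha h₁ g
  have mem_b := memLp_norm_smear_apply hb h₂ h
  have mem_a' := memLp_norm_smear_commutator_apply ha h₂ h₁ (star Q) g
  have mem_b' := memLp_norm_smear_commutator_apply hb h₁ h₂ Q h
  have I₁ : Integrable fun z ↦ ‖smear a N₁ z g‖ * ‖(smear b N₁ z * Q - Q * smear b N₂ z) h‖ :=
    mem_a.integrable_mul mem_b'
  have I₂ : Integrable fun z ↦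
      ‖(smear a N₂ z * star Q - star Q * smear a N₁ z) g‖ * ‖smear b N₂ z h‖ :=
    mem_a'.integrable_mul mem_b
  have C₁ := (integral_mul_le_sqrt_mul_sqrt mem_a mem_b' (fun _ ↦ norm_nonneg _)
    (fun _ ↦ norm_nonneg _)).trans (mul_le_mul
      (sqrt_integral_norm_smear_apply_sq_le ha h₁ g)
      (sqrt_integral_norm_smear_commutator_apply_sq_le hb h₁ h₂ Q h)
      (by positivity) (by positivity))
  have C₂ := (integral_mul_le_sqrt_mul_sqrt mem_a' mem_b (fun _ ↦ norm_nonneg _)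
    (fun _ ↦ norm_nonneg _)).trans (mul_le_mul
      (sqrt_integral_norm_smear_commutator_apply_sq_le ha h₂ h₁ (star Q) g)
      (sqrt_integral_norm_smear_apply_sq_le hb h₂ h)
      (by positivity) (by positivity))
  rw [hδ', hg, mul_one] at C₂
  rw [hh, mul_one] at C₂
  rw [← hδ, hh, hg, mul_one, mul_one] at C₁
  calc RCLike.re (inner ℂ ((cfc f N₁ * Q - Q * cfc f N₂) h) g)
      ≤ ‖L (cfc f N₁ * Q - Q * cfc f N₂)‖ := by
        rw [inner_re_symm]
        exact RCLike.re_le_norm _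
    _ = ‖∫ z, L (f z • (smear a N₁ z * smear b N₁ z * Q
          - Q * (smear a N₂ z * smear b N₂ z)))‖ := by
        rw [hT, L.integral_comp_comm iT]
    _ ≤ ∫ z, ‖f‖ * (‖smear a N₁ z g‖ * ‖(smear b N₁ z * Q - Q * smear b N₂ z) h‖
          + ‖(smear a N₂ z * star Q - star Q * smear a N₁ z) g‖ * ‖smear b N₂ z h‖) := by
        refine norm_integral_le_of_norm_le ((I₁.add I₂).const_mul _) (.of_forall fun z ↦ ?_)
        rw [map_smul, norm_smul]
        gcongr
        · exact f.norm_coe_le_norm z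
        · exact norm_inner_smear_commutator_le ha' b N₁ N₂ Q z h g
    _ ≤ ‖f‖ * (√(∫ v, ‖a v‖ ^ 2) * (√(∫ v, ‖b v‖ ^ 2 * ‖v‖ ^ 2) * (2 * π * δ))
          + √(∫ v, ‖a v‖ ^ 2 * ‖v‖ ^ 2) * (2 * π * δ) * √(∫ v, ‖b v‖ ^ 2)) := by
        rw [integral_const_mul, integral_add I₁ I₂]
        gcongr
    _ = _ := by ring

end SquareFunction

section Cutoffs

open Real
open scoped SchwartzMap

theorem volume_real_closedBall_complex (c : ℂ) {r : ℝ} (hr : 0 ≤ r) :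
    volume.real (Metric.closedBall c r) = π * r ^ 2 := by
  rw [measureReal_def, Complex.volume_closedBall, ENNReal.toReal_mul, ENNReal.toReal_pow,
    ENNReal.toReal_ofReal hr, mul_comm, ENNReal.coe_toReal, NNReal.coe_real_pi]

theorem sqrt_integral_sq_le_of_support {u : ℂ → ℝ} {c R : ℝ} (hc : 0 ≤ c) (hR : 0 ≤ R)
    (hu : ∀ v, ‖v‖ ≤ R → u v ≤ c ^ 2) (hu0 : ∀ v, 0 ≤ u v) (hu' : ∀ v, R < ‖v‖ → u v = 0) :
    √(∫ v, u v) ≤ c * (√π * R) := by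
  refine sqrt_le_iff.2 ⟨by positivity, ?_⟩
  have h : ∫ v in Metric.closedBall (0 : ℂ) R, u v = ∫ v, u v :=
    setIntegral_eq_integral_of_forall_compl_eq_zero fun v hv ↦ hu' v (by simpa using hv)
  have key := norm_setIntegral_le_of_norm_le_const (μ := volume)
    (s := Metric.closedBall (0 : ℂ) R) (f := u) (C := c ^ 2)
    measure_closedBall_lt_top fun v hv ↦ by
      rw [norm_of_nonneg (hu0 v)]
      exact hu v (by simpa using hv)
  rw [volume_real_closedBall_complex _ hR, h] at key
  calc ∫ v, u v ≤ c ^ 2 * (π * R ^ 2) := (le_norm_self _).trans key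
    _ = (c * (√π * R)) ^ 2 := by rw [mul_pow, mul_pow, sq_sqrt pi_nonneg]

section SupportBounds

variable {φ : ℂ → ℂ} {c R : ℝ}

theorem sqrt_integral_norm_sq_le_of_support (hc : 0 ≤ c) (hR : 0 ≤ R) (hφ : ∀ v, ‖φ v‖ ≤ c)
    (hφ' : ∀ v, R < ‖v‖ → φ v = 0) : √(∫ v, ‖φ v‖ ^ 2) ≤ c * (√π * R) :=
  sqrt_integral_sq_le_of_support hc hR
    (fun v _ ↦ pow_le_pow_left₀ (norm_nonneg _) (hφ v) 2) (fun _ ↦ by positivity)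
    fun v hv ↦ by simp [hφ' v hv]

theorem sqrt_integral_norm_sq_mul_norm_sq_le_of_support (hc : 0 ≤ c) (hR : 0 ≤ R)
    (hφ : ∀ v, ‖φ v‖ ≤ c) (hφ' : ∀ v, R < ‖v‖ → φ v = 0) :
    √(∫ v, ‖φ v‖ ^ 2 * ‖v‖ ^ 2) ≤ c * R * (√π * R) :=
  sqrt_integral_sq_le_of_support (by positivity) hR
    (fun v hv ↦ by rw [mul_pow]; gcongr; exact hφ v) (fun _ ↦ by positivity)
    fun v hv ↦ by simp [hφ' v hv]

end SupportBounds

theorem star_fourier_eq_of_even {φ : 𝓢(ℂ, ℂ)} (h : ∀ v, star (φ v) = φ v)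
    (h' : ∀ v, φ (-v) = φ v) (z : ℂ) : star (𝓕 φ z) = 𝓕 φ z := by
  rw [SchwartzMap.fourier_coe, Real.fourier_eq, ← starRingEnd_apply, ← integral_conj,
    ← integral_neg_eq_self]
  refine integral_congr_ae (.of_forall fun v ↦ ?_)
  simp only [Circle.smul_def, smul_eq_mul, map_mul, h', inner_neg_left, neg_neg]
  rw [starRingEnd_apply (φ v), h, ← Circle.coe_inv_eq_conj, ← AddChar.map_neg_eq_inv]

theorem exists_normalized_cutoff {σ : ℝ} (hσ : 0 < σ) : ∃ a : 𝓢(ℂ, ℂ), HasCompactSupport a ∧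
    (∀ v, star (a v) = a v) ∧ (∀ v, a (-v) = a v) ∧ (∀ v, ‖a v‖ ≤ 4 / (π * σ ^ 2)) ∧
    (∀ v, σ ≤ ‖v‖ → a v = 0) ∧ ∫ v, a v = 1 := by
  let ρ : ContDiffBump (0 : ℂ) := ⟨σ / 2, σ, by positivity, by linarith⟩
  have hs : HasCompactSupport fun v ↦ (ρ.normed volume v : ℂ) :=
    (ρ.hasCompactSupport_normed (μ := volume)).comp_left Complex.ofReal_zero
  refine ⟨hs.toSchwartzMap (Complex.ofRealCLM.contDiff.comp ρ.contDiff_normed), hs,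
    fun v ↦ Complex.conj_ofReal _, fun v ↦ congrArg Complex.ofReal (ρ.normed_neg v), fun v ↦ ?_,
    fun v hv ↦ ?_, ?_⟩
  · have h := ρ.normed_le_div_measure_closedBall_rIn (μ := volume) v
    rw [volume_real_closedBall_complex _ ρ.rIn_pos.le] at h
    calc ‖(ρ.normed volume v : ℂ)‖ = ρ.normed volume v := by
          rw [Complex.norm_real, norm_of_nonneg (ρ.nonneg_normed v)]
      _ ≤ 1 / (π * (σ / 2) ^ 2) := h
      _ = 4 / (π * σ ^ 2) := by field_simp; norm_num
  · have : v ∉ Function.support (ρ.normed volume) := by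
      rw [ρ.support_normed_eq]
      simpa using hv
    exact congrArg Complex.ofReal (Function.notMem_support.1 this)
  · exact (integral_ofReal).trans (congrArg _ ρ.integral_normed)

theorem exists_plateau_cutoff {r R : ℝ} (hr : 0 < r) (hR : r < R) :
    ∃ b : 𝓢(ℂ, ℂ), HasCompactSupport b ∧ (∀ v, ‖b v‖ ≤ 1) ∧ (∀ v, R ≤ ‖v‖ → b v = 0) ∧
      ∀ v, ‖v‖ ≤ r → b v = 1 := by
  let ρ : ContDiffBump (0 : ℂ) := ⟨r, R, hr, hR⟩
  have hs : HasCompactSupport fun v ↦ (ρ v : ℂ) :=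
    ρ.hasCompactSupport.comp_left Complex.ofReal_zero
  refine ⟨hs.toSchwartzMap (Complex.ofRealCLM.contDiff.comp ρ.contDiff), hs, fun v ↦ ?_,
    fun v hv ↦ ?_, fun v hv ↦ ?_⟩
  · calc ‖(ρ v : ℂ)‖ = ρ v := by rw [Complex.norm_real, norm_of_nonneg ρ.nonneg]
      _ ≤ 1 := ρ.le_one
  · exact congrArg Complex.ofReal (ρ.zero_of_le_dist (by simpa using hv))
  · exact congrArg Complex.ofReal (ρ.one_of_mem_closedBall (by simpa using hv))

theorem convolution_eq_one {a b : 𝓢(ℂ, ℂ)} {s r : ℝ} (ha : ∀ v, s ≤ ‖v‖ → a v = 0)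
    (ha' : ∫ v, a v = 1) (hb : ∀ v, ‖v‖ ≤ r + s → b v = 1) {ξ : ℂ}
    (hξ : ξ ∈ Metric.ball (0 : ℂ) r) :
    SchwartzMap.convolution (ContinuousLinearMap.mul ℂ ℂ) a b ξ = 1 := by
  rw [SchwartzMap.convolution_apply, convolution_def, ← ha']
  refine integral_congr_ae (.of_forall fun t ↦ ?_)
  rcases le_or_gt s ‖t‖ with ht | ht
  · simp [ha t ht]
  · have : ‖ξ - t‖ ≤ r + s :=
      (norm_sub_le _ _).trans (add_le_add (mem_ball_zero_iff.1 hξ).le ht.le)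
    simp [hb _ this]

theorem norm_cfc_mul_sub_mul_cfc_le_of_fourierSupportedIn {σ : ℝ} (hσ : 0 < σ)
    {f : BoundedContinuousFunction ℂ ℂ} (hf : FourierSupportedIn f σ) {H : Type*}
    [NormedAddCommGroup H] [InnerProductSpace ℂ H] [CompleteSpace H] {N₁ N₂ : H →L[ℂ] H}
    (h₁ : IsStarNormal N₁) (h₂ : IsStarNormal N₂) (Q : H →L[ℂ] H) :
    ‖cfc f N₁ * Q - Q * cfc f N₂‖ ≤
      160 * π * σ * ‖f‖ * max ‖N₁ * Q - Q * N₂‖ ‖star N₁ * Q - Q * star N₂‖ := by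
  obtain ⟨a, a_supp, a_star, a_even, a_le, a_zero, a_int⟩ := exists_normalized_cutoff hσ
  obtain ⟨b, b_supp, b_le, b_zero, b_one⟩ :=
    exists_plateau_cutoff (show 0 < 2 * σ + σ by positivity) (show 2 * σ + σ < 4 * σ by linarith)
  have hκ : ∀ z, 𝓕 (SchwartzMap.convolution (ContinuousLinearMap.mul ℂ ℂ) a b) z
      = 𝓕 a z * 𝓕 b z := fun z ↦ by
    rw [SchwartzMap.fourier_convolution, SchwartzMap.pairing_apply_apply,
      ContinuousLinearMap.mul_apply']
  refine (norm_cfc_mul_sub_mul_cfc_le f a_supp b_supp (star_fourier_eq_of_even a_star a_even) hκ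
    (hf.eq_integral (by linarith : σ < 2 * σ) _ fun ξ ↦ convolution_eq_one a_zero a_int b_one)
    h₁ h₂ Q).trans ?_
  have a_zero' := fun v (hv : σ < ‖v‖) ↦ a_zero v hv.le
  have b_zero' := fun v (hv : 4 * σ < ‖v‖) ↦ b_zero v hv.le
  have c_nonneg : 0 ≤ 4 / (π * σ ^ 2) := by positivity
  have R_nonneg : 0 ≤ 4 * σ := by positivity
  have h : √(∫ v, ‖a v‖ ^ 2) * √(∫ v, ‖b v‖ ^ 2 * ‖v‖ ^ 2)
      + √(∫ v, ‖a v‖ ^ 2 * ‖v‖ ^ 2) * √(∫ v, ‖b v‖ ^ 2) ≤ 80 * σ := by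
    calc _ ≤ 4 / (π * σ ^ 2) * (√π * σ) * (1 * (4 * σ) * (√π * (4 * σ)))
          + 4 / (π * σ ^ 2) * σ * (√π * σ) * (1 * (√π * (4 * σ))) := by
          gcongr
          · exact sqrt_integral_norm_sq_le_of_support c_nonneg hσ.le a_le a_zero'
          · exact sqrt_integral_norm_sq_mul_norm_sq_le_of_support zero_le_one R_nonneg b_le b_zero'
          · exact sqrt_integral_norm_sq_mul_norm_sq_le_of_support c_nonneg hσ.le a_le a_zero'
          · exact sqrt_integral_norm_sq_le_of_support zero_le_one R_nonneg b_le b_zero'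
      _ = 80 * σ * (√π ^ 2 / π) := by field_simp; ring
      _ = 80 * σ := by rw [sq_sqrt pi_nonneg, div_self pi_ne_zero, mul_one]
  calc _ ≤ 2 * π * (80 * σ) * ‖f‖ * max ‖N₁ * Q - Q * N₂‖ ‖star N₁ * Q - Q * star N₂‖ := by
        gcongr
    _ = _ := by ring

end Cutoffs

/-- Quasicommutator version of the key inequality: there is an absolute constant `C > 0`
such that for every `σ > 0`, every bounded continuous `f : ℂ → ℂ` with Fourier transform
supported in the closed disc of radius `σ`, all bounded normal operators `N₁, N₂` and every
bounded operator `Q`,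
`‖f(N₁)Q - Q f(N₂)‖ ≤ C σ ‖f‖_∞ max{‖N₁Q - QN₂‖, ‖N₁*Q - QN₂*‖}`. -/
theorem key_inequality_band_limited_quasicommutator :
    ∃ C : ℝ, 0 < C ∧
      ∀ (σ : ℝ), 0 < σ →
      ∀ f : BoundedContinuousFunction ℂ ℂ, FourierSupportedIn (⇑f) σ →
      ∀ (H : Type*) [NormedAddCommGroup H] [InnerProductSpace ℂ H] [CompleteSpace H]
        (N₁ N₂ : H →L[ℂ] H), IsStarNormal N₁ → IsStarNormal N₂ →
        ∀ Q : H →L[ℂ] H,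
        ‖cfc (⇑f) N₁ * Q - Q * cfc (⇑f) N₂‖ ≤
          C * σ * ‖f‖ * max ‖N₁ * Q - Q * N₂‖ ‖star N₁ * Q - Q * star N₂‖ := by
  refine ⟨160 * Real.pi, by positivity, fun σ hσ f hf H _ _ _ N₁ N₂ h₁ h₂ Q ↦ ?_⟩
  exact norm_cfc_mul_sub_mul_cfc_le_of_fourierSupportedIn hσ hf h₁ h₂ Q
end

section
/- There exists an absolute constant c > 0 such that for every α ∈ (0,1), every f in the Hölder class Λ_α(ℝ²), every bounded normal operator N on a complex Hilbert space H, and every bounded operator Q on H, the commutator satisfies ‖f(N)Q − Q f(N)‖ ≤ c · (1−α)^{-1} · ‖f‖_{Λ_α} · ‖Q‖^{1−α} · ( max{ ‖NQ − QN‖, ‖N*Q − QN*‖ } )^α. -/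
namespace HolderCommutator

section Diagonal

variable {J E : Type*} [NormedAddCommGroup E] [NormedSpace ℂ E]

/-- The bounded map `E → ℓ²(J, F)` with the given components. -/
noncomputable def column {F : Type*} [NormedAddCommGroup F] [NormedSpace ℂ F]
    (T : J → F →L[ℂ] E) : F →L[ℂ] PiLp 2 (fun _ : J => E) :=
  ((PiLp.continuousLinearEquiv 2 ℂ (fun _ : J => E)).symm :
    (J → E) →L[ℂ] PiLp 2 (fun _ : J => E)) ∘L ContinuousLinearMap.pi T

@[simp]
theorem column_apply {F : Type*} [NormedAddCommGroup F] [NormedSpace ℂ F]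
    (T : J → F →L[ℂ] E) (x : F) (j : J) : column T x j = T j x := rfl

variable [Fintype J]

/-- The diagonal operator with entries `a j` on `ℓ²(J, E)`. -/
noncomputable def diagOp (E : Type*) [NormedAddCommGroup E] [NormedSpace ℂ E] (a : J → ℂ) :
    PiLp 2 (fun _ : J => E) →L[ℂ] PiLp 2 (fun _ : J => E) :=
  column fun j => a j • PiLp.proj 2 (𝕜 := ℂ) (fun _ : J => E) j

@[simp]
theorem diagOp_apply (a : J → ℂ) (x : PiLp 2 (fun _ : J => E)) (j : J) :
    diagOp E a x j = a j • x j := rfl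

theorem diagOp_mul (a b : J → ℂ) : diagOp E a * diagOp E b = diagOp E (a * b) := by
  ext x j
  simp [mul_smul]

theorem diagOp_add (a b : J → ℂ) : diagOp E (a + b) = diagOp E a + diagOp E b := by
  ext x j
  simp [add_smul]

theorem norm_diagOp_le {a : J → ℂ} {B : ℝ} (hB : 0 ≤ B) (h : ∀ j, ‖a j‖ ≤ B) :
    ‖diagOp E a‖ ≤ B := by
  refine ContinuousLinearMap.opNorm_le_bound _ hB fun x => ?_
  refine le_of_sq_le_sq ?_ (by positivity)
  rw [mul_pow, PiLp.norm_sq_eq_of_L2, PiLp.norm_sq_eq_of_L2, Finset.mul_sum]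
  refine Finset.sum_le_sum fun j _ => ?_
  rw [diagOp_apply, norm_smul, mul_pow]
  gcongr
  exact h j

/-- The coordinate projection of `ℓ²(J, E)` onto `ℓ²(S, E)`. -/
noncomputable def blockProj (E : Type*) [NormedAddCommGroup E] [NormedSpace ℂ E] (S : Set J) :
    PiLp 2 (fun _ : J => E) →L[ℂ] PiLp 2 (fun _ : J => E) :=
  diagOp E (S.indicator 1)

theorem blockProj_mul_self (S : Set J) : blockProj E S * blockProj E S = blockProj E S := by
  rw [blockProj, diagOp_mul]
  congr 1
  ext j
  by_cases hj : j ∈ S <;> simp [hj]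

theorem blockProj_union {S T : Set J} (h : Disjoint S T) :
    blockProj E (S ∪ T) = blockProj E S + blockProj E T := by
  rw [blockProj, Set.indicator_union_of_disjoint h]
  exact diagOp_add _ _

theorem blockProj_univ : blockProj E (Set.univ : Set J) = 1 := by
  ext x j
  simp [blockProj]

theorem blockProj_empty : blockProj E (∅ : Set J) = 0 := by
  ext x j
  simp [blockProj]

open Classical in
theorem norm_blockProj_apply_sq (S : Set J) (x : PiLp 2 (fun _ : J => E)) :
    ‖blockProj E S x‖ ^ 2 = ∑ j with j ∈ S, ‖x j‖ ^ 2 := by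
  rw [PiLp.norm_sq_eq_of_L2, Finset.sum_filter]
  refine Finset.sum_congr rfl fun j _ => ?_
  by_cases hj : j ∈ S <;> simp [blockProj, hj]

/-- The operator obtained from `X` by keeping only the matrix entries `(i, j)` with `r i j`. -/
noncomputable def restrictEntries (r : J → J → Prop)
    (X : PiLp 2 (fun _ : J => E) →L[ℂ] PiLp 2 (fun _ : J => E)) :
    PiLp 2 (fun _ : J => E) →L[ℂ] PiLp 2 (fun _ : J => E) :=
  column fun i => PiLp.proj 2 (𝕜 := ℂ) (fun _ : J => E) i ∘L X ∘L blockProj E {j | r i j}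

theorem restrictEntries_apply (r : J → J → Prop)
    (X : PiLp 2 (fun _ : J => E) →L[ℂ] PiLp 2 (fun _ : J => E))
    (x : PiLp 2 (fun _ : J => E)) (i : J) :
    restrictEntries r X x i = X (blockProj E {j | r i j} x) i := rfl

theorem restrictEntries_of_forall {r : J → J → Prop} (h : ∀ i j, r i j)
    (X : PiLp 2 (fun _ : J => E) →L[ℂ] PiLp 2 (fun _ : J => E)) : restrictEntries r X = X := by
  ext x i
  simp [restrictEntries_apply, h, blockProj_univ]

theorem restrictEntries_or {r s : J → J → Prop} (h : ∀ i j, r i j → ¬ s i j)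
    (X : PiLp 2 (fun _ : J => E) →L[ℂ] PiLp 2 (fun _ : J => E)) :
    restrictEntries (fun i j => r i j ∨ s i j) X = restrictEntries r X + restrictEntries s X := by
  ext x i
  have hd : Disjoint {j | r i j} {j | s i j} := Set.disjoint_left.2 (h i)
  have hu : {j | r i j ∨ s i j} = {j | r i j} ∪ {j | s i j} := rfl
  simp [restrictEntries_apply, hu, blockProj_union hd]

theorem restrictEntries_exists_mem {ι : Type*} (s : Finset ι) (r : ι → J → J → Prop)
    (h : ∀ d ∈ s, ∀ e ∈ s, ∀ i j, r d i j → r e i j → d = e)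
    (X : PiLp 2 (fun _ : J => E) →L[ℂ] PiLp 2 (fun _ : J => E)) :
    restrictEntries (fun i j => ∃ d ∈ s, r d i j) X = ∑ d ∈ s, restrictEntries (r d) X := by
  classical
  induction s using Finset.induction_on with
  | empty =>
    ext x i
    simp [restrictEntries_apply, blockProj_empty]
  | insert a s ha ih =>
    rw [Finset.sum_insert ha, ← ih fun d hd e he =>
      h d (Finset.mem_insert_of_mem hd) e (Finset.mem_insert_of_mem he), ← restrictEntries_or]
    · simp
    · rintro i j hr ⟨d, hd, hrd⟩
      have := h a (Finset.mem_insert_self _ _) d (Finset.mem_insert_of_mem hd) i j hr hrd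
      exact ha (this ▸ hd)

/-- A block-diagonal operator is bounded by the supremum of its blocks. -/
theorem norm_restrictEntries_le_of_blocks {I : Type*} (κ : J → I) (R : I → J → Prop)
    (hR : ∀ C C' j, R C j → R C' j → C = C') {B : ℝ} (hB : 0 ≤ B)
    (X : PiLp 2 (fun _ : J => E) →L[ℂ] PiLp 2 (fun _ : J => E))
    (hX : ∀ C, ‖blockProj E {i | κ i = C} * X * blockProj E {j | R C j}‖ ≤ B) :
    ‖restrictEntries (fun i j => R (κ i) j) X‖ ≤ B := by
  classical
  refine ContinuousLinearMap.opNorm_le_bound _ hB fun x => ?_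
  refine le_of_sq_le_sq ?_ (by positivity)
  rw [mul_pow, PiLp.norm_sq_eq_of_L2]
  calc ∑ i, ‖restrictEntries (fun i j => R (κ i) j) X x i‖ ^ 2
      = ∑ C ∈ Finset.univ.image κ,
          ‖(blockProj E {i | κ i = C} * X * blockProj E {j | R C j})
            (blockProj E {j | R C j} x)‖ ^ 2 := by
        rw [← Finset.sum_fiberwise_of_maps_to (t := Finset.univ.image κ) (g := κ)
          fun i _ => Finset.mem_image_of_mem _ (Finset.mem_univ i)]
        refine Finset.sum_congr rfl fun C _ => ?_
        have h1 : (blockProj E {i | κ i = C} * X * blockProj E {j | R C j})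
            (blockProj E {j | R C j} x) =
            blockProj E {i | κ i = C} (X (blockProj E {j | R C j} x)) := by
          change blockProj E {i | κ i = C} (X ((blockProj E {j | R C j} *
            blockProj E {j | R C j}) x)) = _
          rw [blockProj_mul_self]
        rw [h1, norm_blockProj_apply_sq]
        refine Finset.sum_congr (by ext; simp) fun i hi => ?_
        rw [restrictEntries_apply]
        have : κ i = C := by simpa using hi
        rw [this]
    _ ≤ ∑ C ∈ Finset.univ.image κ, B ^ 2 * ∑ j, if R C j then ‖x j‖ ^ 2 else 0 := by
        refine Finset.sum_le_sum fun C _ => ?_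
        have h2 := norm_blockProj_apply_sq {j | R C j} x
        rw [Finset.sum_filter] at h2
        simp only [Set.mem_ofPred_eq] at h2
        rw [← h2, ← mul_pow]
        gcongr
        exact (ContinuousLinearMap.le_opNorm _ _).trans (by gcongr; exact hX C)
    _ ≤ B ^ 2 * ‖x‖ ^ 2 := by
        rw [← Finset.mul_sum, Finset.sum_comm, PiLp.norm_sq_eq_of_L2]
        gcongr with j
        by_cases hj : ∃ C, R C j
        · obtain ⟨C, hC⟩ := hj
          calc ∑ C' ∈ Finset.univ.image κ, (if R C' j then ‖x j‖ ^ 2 else 0)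
              ≤ ∑ C' ∈ Finset.univ.image κ, (if C = C' then ‖x j‖ ^ 2 else 0) := by
                refine Finset.sum_le_sum fun C' _ => ?_
                by_cases h : R C' j
                · simp [h, hR C C' j hC h]
                · simp only [h, if_false]
                  positivity
            _ ≤ ‖x j‖ ^ 2 := by
                rw [Finset.sum_ite_eq]
                split_ifs <;> simp
        · push Not at hj
          simp [hj]

/-- Banded version of `norm_restrictEntries_le_of_blocks`: entries whose labels in `ℤ × ℤ` differ
by at most `3` in each coordinate. -/
theorem norm_restrictEntries_le_of_band (κ : J → ℤ × ℤ) (w : ℤ × ℤ → ℤ × ℤ → Prop)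
    (hw : ∀ C C', w C C' → C' - C ∈ Finset.Icc (-3 : ℤ) 3 ×ˢ Finset.Icc (-3 : ℤ) 3)
    {B : ℝ} (hB : 0 ≤ B) (X : PiLp 2 (fun _ : J => E) →L[ℂ] PiLp 2 (fun _ : J => E))
    (hX : ∀ C C', w C C' →
      ‖blockProj E {i | κ i = C} * X * blockProj E {j | κ j = C'}‖ ≤ B) :
    ‖restrictEntries (fun i j => w (κ i) (κ j)) X‖ ≤ 49 * B := by
  have h : (fun i j => w (κ i) (κ j)) = fun i j =>
      ∃ d ∈ Finset.Icc (-3 : ℤ) 3 ×ˢ Finset.Icc (-3 : ℤ) 3,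
        κ j = κ i + d ∧ w (κ i) (κ i + d) := by
    ext i j
    constructor
    · intro hij
      exact ⟨κ j - κ i, hw _ _ hij, by abel, by simpa using hij⟩
    · rintro ⟨d, -, h1, h2⟩
      rwa [h1]
  rw [h, restrictEntries_exists_mem _ fun d i j => κ j = κ i + d ∧ w (κ i) (κ i + d)]
  · refine (norm_sum_le_of_le (n := fun _ => B) _ fun d _ => ?_).trans_eq (by simp)
    refine norm_restrictEntries_le_of_blocks κ (fun C j => κ j = C + d ∧ w C (C + d)) ?_ hB X ?_
    · rintro C C' j ⟨h1, -⟩ ⟨h2, -⟩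
      exact add_right_cancel (h1.symm.trans h2)
    · intro C
      by_cases hC : w C (C + d)
      · simpa [hC] using hX C (C + d) hC
      · simpa [hC, blockProj_empty] using hB
  · rintro d - e - i j ⟨h1, -⟩ ⟨h2, -⟩
    exact add_left_cancel (h1.symm.trans h2)

end Diagonal
theorem mul_commutator_mul {A : Type*} [Ring A] [Algebra ℂ A] {p q a l r x : A} (u v : ℂ)
    (hp : p * a = l * p + u • p) (hq : a * q = q * r + v • q) :
    p * (a * x - x * a) * q = l * (p * x * q) - p * x * q * r + (u - v) • (p * x * q) := by
  calc p * (a * x - x * a) * q = p * a * x * q - p * x * (a * q) := by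
        simp only [mul_sub, sub_mul, mul_assoc]
    _ = _ := by
        rw [hp, hq]
        simp only [add_mul, mul_add, smul_mul_assoc, mul_smul_comm, sub_smul, mul_assoc]
        abel

section Blocks

variable {J E : Type*} [Fintype J] [NormedAddCommGroup E] [NormedSpace ℂ E]

theorem block_commutator_eq (S T : Set J) (a : J → ℂ) (u v : ℂ)
    (Q : PiLp 2 (fun _ : J => E) →L[ℂ] PiLp 2 (fun _ : J => E)) :
    blockProj E S * (diagOp E a * Q - Q * diagOp E a) * blockProj E T =
      diagOp E (S.indicator fun j => a j - u) * (blockProj E S * Q * blockProj E T) -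
      (blockProj E S * Q * blockProj E T) * diagOp E (T.indicator fun j => a j - v) +
      (u - v) • (blockProj E S * Q * blockProj E T) := by
  have h (S : Set J) (u : ℂ) : diagOp E a * blockProj E S =
      diagOp E (S.indicator fun j => a j - u) * blockProj E S + u • blockProj E S := by
    ext x j
    by_cases hj : j ∈ S <;> simp [blockProj, hj, sub_smul]
  have h' (S : Set J) : blockProj E S * diagOp E a = diagOp E a * blockProj E S := by
    rw [blockProj, diagOp_mul, diagOp_mul, mul_comm]
  have h'' (S : Set J) (b : J → ℂ) : blockProj E S * diagOp E b = diagOp E b * blockProj E S := by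
    rw [blockProj, diagOp_mul, diagOp_mul, mul_comm]
  exact mul_commutator_mul u v ((h' S).trans (h S u)) ((h T v).trans (by rw [h'']))

theorem norm_diagOp_indicator_le {S : Set J} {a : J → ℂ} {B : ℝ} (hB : 0 ≤ B)
    (h : ∀ j ∈ S, ‖a j‖ ≤ B) : ‖diagOp E (S.indicator a)‖ ≤ B := by
  refine norm_diagOp_le hB fun j => ?_
  by_cases hj : j ∈ S
  · simpa [hj] using h j hj
  · simpa [hj] using hB

theorem norm_block_commutator_le {S T : Set J} {a : J → ℂ} {z : ℂ} {η : ℝ} (hη : 0 ≤ η)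
    (hS : ∀ j ∈ S, ‖a j - z‖ ≤ η) (hT : ∀ j ∈ T, ‖a j - z‖ ≤ η)
    (Q : PiLp 2 (fun _ : J => E) →L[ℂ] PiLp 2 (fun _ : J => E)) :
    ‖blockProj E S * (diagOp E a * Q - Q * diagOp E a) * blockProj E T‖ ≤
      2 * η * ‖blockProj E S * Q * blockProj E T‖ := by
  have h0 : blockProj E S * (diagOp E a * Q - Q * diagOp E a) * blockProj E T =
      diagOp E (S.indicator fun j => a j - z) * (blockProj E S * Q * blockProj E T) -
      (blockProj E S * Q * blockProj E T) * diagOp E (T.indicator fun j => a j - z) := by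
    refine (block_commutator_eq S T a z z Q).trans ?_
    rw [sub_self]
    refine add_eq_left.2 ?_
    ext x j
    simp
  rw [h0]
  refine (norm_sub_le _ _).trans ?_
  have h1 := norm_mul_le (diagOp E (S.indicator fun j => a j - z))
    (blockProj E S * Q * blockProj E T)
  have h2 := norm_mul_le (blockProj E S * Q * blockProj E T)
    (diagOp E (T.indicator fun j => a j - z))
  have h3 := mul_le_mul_of_nonneg_right (norm_diagOp_indicator_le (E := E) hη hS)
    (norm_nonneg (blockProj E S * Q * blockProj E T))
  have h4 := mul_le_mul_of_nonneg_left (norm_diagOp_indicator_le (E := E) hη hT)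
    (norm_nonneg (blockProj E S * Q * blockProj E T))
  linarith

theorem norm_blockProj_le_one (S : Set J) : ‖blockProj E S‖ ≤ 1 :=
  norm_diagOp_indicator_le zero_le_one (by simp)

theorem norm_block_le (S T : Set J)
    (Q : PiLp 2 (fun _ : J => E) →L[ℂ] PiLp 2 (fun _ : J => E)) :
    ‖blockProj E S * Q * blockProj E T‖ ≤ ‖Q‖ := by
  calc ‖blockProj E S * Q * blockProj E T‖
      ≤ ‖blockProj E S‖ * ‖Q‖ * ‖blockProj E T‖ := norm_mul₃_le
    _ ≤ 1 * ‖Q‖ * 1 := by gcongr <;> exact norm_blockProj_le_one _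
    _ = ‖Q‖ := by ring

/-- A block between two separated parts of the spectrum is controlled by the commutator. -/
theorem norm_block_le_of_separated {S T : Set J} {a : J → ℂ} {u v : ℂ} {η : ℝ} (hη : 0 ≤ η)
    (hS : ∀ j ∈ S, ‖a j - u‖ ≤ η) (hT : ∀ j ∈ T, ‖a j - v‖ ≤ η)
    (Q : PiLp 2 (fun _ : J => E) →L[ℂ] PiLp 2 (fun _ : J => E)) :
    (‖u - v‖ - 2 * η) * ‖blockProj E S * Q * blockProj E T‖ ≤
      ‖diagOp E a * Q - Q * diagOp E a‖ := by
  have h0 := norm_block_le S T (diagOp E a * Q - Q * diagOp E a)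
  rw [block_commutator_eq S T a u v] at h0
  set Y := blockProj E S * Q * blockProj E T
  set A := diagOp E (S.indicator fun j => a j - u)
  set B := diagOp E (T.indicator fun j => a j - v)
  have h1 : ‖(u - v) • Y‖ ≤ ‖A * Y - Y * B + (u - v) • Y‖ + ‖A * Y‖ + ‖Y * B‖ := by
    have : (u - v) • Y = (A * Y - Y * B + (u - v) • Y) - A * Y + Y * B := by abel
    rw [this]
    refine (norm_add_le _ _).trans ?_
    rw [← this]
    gcongr
    exact norm_sub_le _ _
  have h2 : ‖A * Y‖ ≤ η * ‖Y‖ := (norm_mul_le _ _).trans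
    (mul_le_mul_of_nonneg_right (norm_diagOp_indicator_le hη hS) (norm_nonneg _))
  have h3 : ‖Y * B‖ ≤ ‖Y‖ * η := (norm_mul_le _ _).trans
    (mul_le_mul_of_nonneg_left (norm_diagOp_indicator_le hη hT) (norm_nonneg _))
  rw [norm_smul] at h1
  linarith

end Blocks

section Cells

/-- The index of the half-open square of side `ρ` containing `z`. -/
noncomputable def cell (ρ : ℝ) (z : ℂ) : ℤ × ℤ := (⌊z.re / ρ⌋, ⌊z.im / ρ⌋)

/-- The centre of the square of side `ρ` with index `C`. -/
noncomputable def cellCentre (ρ : ℝ) (C : ℤ × ℤ) : ℂ := ⟨ρ * (C.1 + 1 / 2), ρ * (C.2 + 1 / 2)⟩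

/-- Two squares of the same grid are equal or touch each other. -/
def Near (C C' : ℤ × ℤ) : Prop := |C'.1 - C.1| ≤ 1 ∧ |C'.2 - C.2| ≤ 1

/-- The index of the square of the grid of double size containing the square `C`. -/
def parent (C : ℤ × ℤ) : ℤ × ℤ := (C.1 / 2, C.2 / 2)

theorem cell_two_mul (ρ : ℝ) (z : ℂ) : cell (2 * ρ) z = parent (cell ρ z) := by
  have h (x : ℝ) : ⌊x / (2 * ρ)⌋ = ⌊x / ρ⌋ / 2 := by
    have := Int.floor_div_natCast (x / ρ) 2
    rw [← div_div, div_right_comm]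
    exact_mod_cast this
  simp [cell, parent, h]

theorem Near.parent {C C' : ℤ × ℤ} (h : Near C C') : Near (parent C) (parent C') := by
  simp only [Near, HolderCommutator.parent, abs_le] at *
  omega

theorem Near.sub_mem_of_parent {C C' : ℤ × ℤ} (h : Near (HolderCommutator.parent C)
    (HolderCommutator.parent C')) :
    C' - C ∈ Finset.Icc (-3 : ℤ) 3 ×ˢ Finset.Icc (-3 : ℤ) 3 := by
  simp only [Near, HolderCommutator.parent, abs_le, Finset.mem_product, Finset.mem_Icc,
    Prod.fst_sub, Prod.snd_sub] at *
  omega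

theorem Near.sub_mem {C C' : ℤ × ℤ} (h : Near C C') :
    C' - C ∈ Finset.Icc (-3 : ℤ) 3 ×ˢ Finset.Icc (-3 : ℤ) 3 := by
  simp only [Near, abs_le, Finset.mem_product, Finset.mem_Icc, Prod.fst_sub, Prod.snd_sub] at *
  omega

theorem near_cell_of_norm_lt {ρ : ℝ} {z w : ℂ} (hz : ‖z‖ < ρ) (hw : ‖w‖ < ρ) :
    Near (cell ρ z) (cell ρ w) := by
  have hρ : 0 < ρ := (norm_nonneg z).trans_lt hz
  have h {x : ℝ} (hx : |x| < ρ) : -1 ≤ ⌊x / ρ⌋ ∧ ⌊x / ρ⌋ ≤ 0 := by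
    obtain ⟨h1, h2⟩ := abs_lt.1 hx
    constructor
    · rw [Int.le_floor, le_div_iff₀ hρ]
      push_cast
      linarith
    · rw [← Int.lt_add_one_iff, Int.floor_lt, div_lt_iff₀ hρ]
      push_cast
      linarith
  have h1 := h ((Complex.abs_re_le_norm z).trans_lt hz)
  have h2 := h ((Complex.abs_im_le_norm z).trans_lt hz)
  have h3 := h ((Complex.abs_re_le_norm w).trans_lt hw)
  have h4 := h ((Complex.abs_im_le_norm w).trans_lt hw)
  simp only [Near, cell, abs_le]
  omega

theorem norm_sub_cellCentre_le {ρ : ℝ} (hρ : 0 < ρ) (z : ℂ) :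
    ‖z - cellCentre ρ (cell ρ z)‖ ≤ 3 / 4 * ρ := by
  have h (x : ℝ) : |x - ρ * (⌊x / ρ⌋ + 1 / 2)| ≤ ρ / 2 := by
    have h1 := (le_div_iff₀ hρ).1 (Int.floor_le (x / ρ))
    have h2 := (div_lt_iff₀ hρ).1 (Int.lt_floor_add_one (x / ρ))
    rw [abs_le]
    constructor <;> nlinarith
  refine le_of_sq_le_sq ?_ (by positivity)
  rw [Complex.sq_norm, Complex.normSq_apply]
  have h1 := sq_le_sq' (abs_le.1 (h z.re)).1 (abs_le.1 (h z.re)).2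
  have h2 := sq_le_sq' (abs_le.1 (h z.im)).1 (abs_le.1 (h z.im)).2
  simp only [cellCentre, cell, Complex.sub_re, Complex.sub_im]
  nlinarith [sq_nonneg ρ]

theorem norm_cellCentre_sub_le {ρ : ℝ} (hρ : 0 < ρ) {C C' : ℤ × ℤ}
    (h : C' - C ∈ Finset.Icc (-3 : ℤ) 3 ×ˢ Finset.Icc (-3 : ℤ) 3) :
    ‖cellCentre ρ C' - cellCentre ρ C‖ ≤ 5 * ρ := by
  simp only [Finset.mem_product, Finset.mem_Icc, Prod.fst_sub, Prod.snd_sub] at h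
  obtain ⟨⟨h1, h2⟩, h3, h4⟩ := h
  have k1 : (-3 : ℝ) ≤ C'.1 - C.1 := by exact_mod_cast h1
  have k2 : (C'.1 - C.1 : ℝ) ≤ 3 := by exact_mod_cast h2
  have k3 : (-3 : ℝ) ≤ C'.2 - C.2 := by exact_mod_cast h3
  have k4 : (C'.2 - C.2 : ℝ) ≤ 3 := by exact_mod_cast h4
  have l1 := sq_le_sq' k1 k2
  have l2 := sq_le_sq' k3 k4
  refine le_of_sq_le_sq ?_ (by positivity)
  rw [Complex.sq_norm, Complex.normSq_apply]
  simp only [cellCentre, Complex.sub_re, Complex.sub_im]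
  nlinarith [mul_le_mul_of_nonneg_left (add_le_add l1 l2) (sq_nonneg ρ), sq_nonneg ρ]

theorem two_mul_le_norm_cellCentre_sub {ρ : ℝ} (hρ : 0 < ρ) {C C' : ℤ × ℤ} (h : ¬ Near C C') :
    2 * ρ ≤ ‖cellCentre ρ C - cellCentre ρ C'‖ := by
  have key {m n : ℤ} (hmn : ¬ |n - m| ≤ 1) :
      2 * ρ ≤ |ρ * (m + 1 / 2) - ρ * (n + 1 / 2)| := by
    have h2 : (2 : ℤ) ≤ |n - m| := by omega
    have h3 : (2 : ℝ) ≤ |(n : ℝ) - m| := by exact_mod_cast h2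
    have : ρ * ((m : ℝ) + 1 / 2) - ρ * (n + 1 / 2) = ρ * (m - n) := by ring
    rw [this, abs_mul, abs_of_pos hρ, abs_sub_comm, mul_comm]
    gcongr
  rw [Near, not_and_or] at h
  rcases h with h | h
  · exact (key h).trans (Complex.abs_re_le_norm (cellCentre ρ C - cellCentre ρ C'))
  · exact (key h).trans (Complex.abs_im_le_norm (cellCentre ρ C - cellCentre ρ C'))

end Cells

section Finite

variable {J E : Type*} [Fintype J] [NormedAddCommGroup E] [NormedSpace ℂ E]

theorem norm_cell_block_commutator_le {α M ρ : ℝ} (hα : 0 < α) (hα1 : α < 1) (hM : 0 ≤ M)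
    (hρ : 0 < ρ) {f : ℂ → ℂ} (hf : ∀ z w, ‖f z - f w‖ ≤ M * ‖z - w‖ ^ α) (a : J → ℂ)
    (Q : PiLp 2 (fun _ : J => E) →L[ℂ] PiLp 2 (fun _ : J => E)) {C C' : ℤ × ℤ}
    (h : C' - C ∈ Finset.Icc (-3 : ℤ) 3 ×ˢ Finset.Icc (-3 : ℤ) 3) :
    ‖blockProj E {j | cell ρ (a j) = C} *
        (diagOp E (fun j => f (a j)) * Q - Q * diagOp E fun j => f (a j)) *
        blockProj E {j | cell ρ (a j) = C'}‖ ≤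
      12 * M * ρ ^ α * ‖blockProj E {j | cell ρ (a j) = C} * Q *
        blockProj E {j | cell ρ (a j) = C'}‖ := by
  have key {z : ℂ} (hz : ‖z - cellCentre ρ C‖ ≤ 6 * ρ) :
      ‖f z - f (cellCentre ρ C)‖ ≤ 6 * M * ρ ^ α := by
    calc ‖f z - f (cellCentre ρ C)‖ ≤ M * ‖z - cellCentre ρ C‖ ^ α := hf _ _
      _ ≤ M * (6 * ρ) ^ α := by gcongr
      _ = M * (6 ^ α * ρ ^ α) := by rw [Real.mul_rpow (by norm_num) hρ.le]
      _ ≤ M * (6 ^ (1 : ℝ) * ρ ^ α) := by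
        gcongr
        norm_num
      _ = 6 * M * ρ ^ α := by rw [Real.rpow_one]; ring
  refine (norm_block_commutator_le (z := f (cellCentre ρ C)) (η := 6 * M * ρ ^ α) (by positivity)
    ?_ ?_ Q).trans_eq (by ring)
  · rintro j rfl
    exact key ((norm_sub_cellCentre_le hρ _).trans (by linarith))
  · rintro j rfl
    refine key ?_
    have h1 := norm_sub_cellCentre_le hρ (a j)
    have h2 := norm_cellCentre_sub_le hρ h
    have h3 := norm_sub_le_norm_sub_add_norm_sub (a j) (cellCentre ρ (cell ρ (a j)))
      (cellCentre ρ C)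
    linarith

theorem norm_cell_block_le {ρ : ℝ} (hρ : 0 < ρ) (a : J → ℂ)
    (Q : PiLp 2 (fun _ : J => E) →L[ℂ] PiLp 2 (fun _ : J => E)) {C C' : ℤ × ℤ}
    (h : ¬ Near C C') :
    ‖blockProj E {j | cell ρ (a j) = C} * Q * blockProj E {j | cell ρ (a j) = C'}‖ ≤
      2 * ‖diagOp E a * Q - Q * diagOp E a‖ / ρ := by
  have h1 := norm_block_le_of_separated (S := {j | cell ρ (a j) = C})
    (T := {j | cell ρ (a j) = C'}) (a := a) (u := cellCentre ρ C) (v := cellCentre ρ C')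
    (η := 3 / 4 * ρ) (by positivity) (by rintro j rfl; exact norm_sub_cellCentre_le hρ _)
    (by rintro j rfl; exact norm_sub_cellCentre_le hρ _) Q
  have h2 := two_mul_le_norm_cellCentre_sub hρ h
  rw [le_div_iff₀ hρ]
  have h3 := mul_le_mul_of_nonneg_right (show ρ / 2 ≤ ‖cellCentre ρ C - cellCentre ρ C'‖ -
    2 * (3 / 4 * ρ) by linarith) (norm_nonneg (blockProj E {j | cell ρ (a j) = C} * Q *
      blockProj E {j | cell ρ (a j) = C'}))
  linarith

theorem one_sub_two_rpow_inv_le {α : ℝ} (hα : 0 < α) (hα1 : α < 1) :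
    (1 - (2 : ℝ) ^ (α - 1))⁻¹ ≤ 2 * (1 - α)⁻¹ := by
  have h := Real.geom_mean_le_arith_mean2_weighted (w₁ := α) (w₂ := 1 - α) (p₁ := 1)
    (p₂ := 1 / 2) hα.le (by linarith) (by norm_num) (by norm_num) (by ring)
  have h2 : ((1 : ℝ) / 2) ^ (1 - α) = 2 ^ (α - 1) := by
    rw [one_div, Real.inv_rpow (by norm_num), ← Real.rpow_neg (by norm_num), neg_sub]
  rw [Real.one_rpow, one_mul, h2] at h
  have h3 : (0 : ℝ) < 1 - α := by linarith
  calc (1 - (2 : ℝ) ^ (α - 1))⁻¹ ≤ ((1 - α) / 2)⁻¹ := by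
        gcongr
        linarith
    _ = 2 * (1 - α)⁻¹ := by rw [inv_div]; ring

/-- The commutator estimate for diagonal operators, with a free scale parameter `r`. -/
theorem norm_diagOp_commutator_le {α M r : ℝ} (hα : 0 < α) (hα1 : α < 1) (hM : 0 ≤ M)
    (hr : 0 < r) {f : ℂ → ℂ} (hf : ∀ z w, ‖f z - f w‖ ≤ M * ‖z - w‖ ^ α) (a : J → ℂ)
    (Q : PiLp 2 (fun _ : J => E) →L[ℂ] PiLp 2 (fun _ : J => E)) :
    ‖diagOp E (fun j => f (a j)) * Q - Q * diagOp E fun j => f (a j)‖ ≤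
      2352 * M * (r ^ α * ‖Q‖ +
        (1 - α)⁻¹ * r ^ (α - 1) * ‖diagOp E a * Q - Q * diagOp E a‖) := by
  set X := diagOp E (fun j => f (a j)) * Q - Q * diagOp E fun j => f (a j) with hX
  set δ := ‖diagOp E a * Q - Q * diagOp E a‖ with hδ
  have hδ0 : 0 ≤ δ := norm_nonneg _
  have hρ (k : ℕ) : 0 < 2 ^ k * r := by positivity
  have step (k : ℕ) : ‖restrictEntries (fun i j =>
      Near (cell (2 ^ k * r) (a i)) (cell (2 ^ k * r) (a j))) X‖ ≤
      588 * M * r ^ α * ‖Q‖ +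
        1176 * M * r ^ (α - 1) * δ * ∑ l ∈ Finset.range k, ((2 : ℝ) ^ (α - 1)) ^ l := by
    induction k with
    | zero =>
      simp only [pow_zero, one_mul, Finset.range_zero, Finset.sum_empty, mul_zero, add_zero]
      refine (norm_restrictEntries_le_of_band (fun i => cell r (a i)) Near
        (fun _ _ => Near.sub_mem) (B := 12 * M * r ^ α * ‖Q‖) (by positivity) X
        fun C C' hC => ?_).trans_eq (by ring)
      refine (norm_cell_block_commutator_le hα hα1 hM hr hf a Q hC.sub_mem).trans ?_
      gcongr
      exact norm_block_le _ _ _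
    | succ k ih =>
      have hsplit : (fun i j : J => Near (cell (2 ^ (k + 1) * r) (a i))
          (cell (2 ^ (k + 1) * r) (a j))) = fun i j =>
          Near (cell (2 ^ k * r) (a i)) (cell (2 ^ k * r) (a j)) ∨
          (Near (parent (cell (2 ^ k * r) (a i))) (parent (cell (2 ^ k * r) (a j))) ∧
            ¬ Near (cell (2 ^ k * r) (a i)) (cell (2 ^ k * r) (a j))) := by
        ext i j
        rw [pow_succ', mul_assoc, cell_two_mul, cell_two_mul]
        have := @Near.parent (cell (2 ^ k * r) (a i)) (cell (2 ^ k * r) (a j))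
        tauto
      rw [hsplit, restrictEntries_or (by tauto), Finset.sum_range_succ]
      have hnew := norm_restrictEntries_le_of_band (fun i => cell (2 ^ k * r) (a i))
        (fun C C' => Near (parent C) (parent C') ∧ ¬ Near C C')
        (fun _ _ h => h.1.sub_mem_of_parent)
        (B := 12 * M * (2 ^ k * r) ^ α * (2 * δ / (2 ^ k * r))) (by positivity) X
        fun C C' hC => (norm_cell_block_commutator_le hα hα1 hM (hρ k) hf a Q
          hC.1.sub_mem_of_parent).trans (by gcongr; exact norm_cell_block_le (hρ k) a Q hC.2)
      have hscale : (2 ^ k * r) ^ α / (2 ^ k * r) = r ^ (α - 1) * ((2 : ℝ) ^ (α - 1)) ^ k := by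
        rw [← Real.rpow_sub_one (hρ k).ne', Real.mul_rpow (by positivity) hr.le,
          ← Real.rpow_natCast, ← Real.rpow_natCast, ← Real.rpow_mul (by norm_num),
          ← Real.rpow_mul (by norm_num), mul_comm (k : ℝ), mul_comm]
      have hB : 49 * (12 * M * (2 ^ k * r) ^ α * (2 * δ / (2 ^ k * r))) =
          1176 * M * r ^ (α - 1) * δ * ((2 : ℝ) ^ (α - 1)) ^ k := by
        rw [show 49 * (12 * M * (2 ^ k * r) ^ α * (2 * δ / (2 ^ k * r))) =
          1176 * M * δ * ((2 ^ k * r) ^ α / (2 ^ k * r)) by ring, hscale]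
        ring
      rw [hB] at hnew
      refine (norm_add_le _ _).trans ?_
      linarith
  obtain ⟨k, hk⟩ : ∃ k : ℕ, (∑ j, ‖a j‖) / r < 2 ^ k := pow_unbounded_of_one_lt _ one_lt_two
  rw [div_lt_iff₀ hr] at hk
  have ha (j : J) : ‖a j‖ < 2 ^ k * r :=
    (Finset.single_le_sum (f := fun j => ‖a j‖) (fun _ _ => norm_nonneg _)
      (Finset.mem_univ j)).trans_lt hk
  have hfin := step k
  rw [restrictEntries_of_forall fun i j => near_cell_of_norm_lt (ha i) (ha j)] at hfin
  have hq : (2 : ℝ) ^ (α - 1) < 1 :=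
    Real.rpow_lt_one_of_one_lt_of_neg one_lt_two (by linarith)
  have hgeom : ∑ l ∈ Finset.range k, ((2 : ℝ) ^ (α - 1)) ^ l ≤ 2 * (1 - α)⁻¹ := by
    refine le_trans ?_ (one_sub_two_rpow_inv_le hα hα1)
    rw [← tsum_geometric_of_lt_one (by positivity) hq]
    exact (summable_geometric_of_lt_one (by positivity) hq).sum_le_tsum _
      fun _ _ => by positivity
  have h1 := mul_le_mul_of_nonneg_left hgeom
    (show 0 ≤ 1176 * M * r ^ (α - 1) * δ by positivity)
  have h2 : 0 ≤ M * r ^ α * ‖Q‖ := by positivity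
  linarith

end Finite

section Dilation

open scoped InnerProductSpace
open ContinuousLinearMap (adjoint)

theorem exists_sq_partition {S : Set ℂ} (hS : IsCompact S) {ε : ℝ} (hε : 0 < ε) :
    ∃ (t : Finset ℂ) (ψ : t → ℂ → ℝ), (∀ c, ContinuousOn (ψ c) S) ∧
      (∀ z ∈ S, ∑ c, ψ c z ^ 2 = 1) ∧ ∀ c z, ψ c z ≠ 0 → ‖(c : ℂ) - z‖ ≤ ε := by
  obtain ⟨t, -, ht, hcov⟩ := hS.finite_cover_balls hε
  let b (c z : ℂ) : ℝ := max 0 (ε - ‖c - z‖)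
  have hb (c : ℂ) : Continuous (b c) := by fun_prop
  let s (z : ℂ) : ℝ := ∑ c : ht.toFinset, b c z ^ 2
  have hs : Continuous s := by fun_prop
  have hpos : ∀ z ∈ S, 0 < s z := by
    intro z hz
    obtain ⟨c, hc, hzc⟩ := Set.mem_iUnion₂.1 (hcov hz)
    refine Finset.sum_pos' (fun _ _ => sq_nonneg _)
      ⟨⟨c, ht.mem_toFinset.2 hc⟩, Finset.mem_univ _, ?_⟩
    rw [Metric.mem_ball, dist_comm, dist_eq_norm] at hzc
    have : 0 < b c z := lt_max_of_lt_right (by linarith)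
    positivity
  refine ⟨ht.toFinset, fun c z => b c z / √(s z), fun c => ?_, fun z hz => ?_, fun c z h => ?_⟩
  · exact (hb c).continuousOn.div (hs.sqrt.continuousOn) fun z hz =>
      (Real.sqrt_pos.2 (hpos z hz)).ne'
  · simp_rw [div_pow, Real.sq_sqrt (hpos z hz).le]
    rw [← Finset.sum_div, div_self (hpos z hz).ne']
  · by_contra! hlt
    exact h (by simp [b, max_eq_left (show ε - ‖(c : ℂ) - z‖ ≤ 0 by linarith)])

variable {J H : Type*} [Fintype J] [NormedAddCommGroup H] [InnerProductSpace ℂ H]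
  [CompleteSpace H]

theorem adjoint_column_comp_column (S T : J → H →L[ℂ] H) :
    adjoint (column S) ∘L column T = ∑ j, star (S j) * T j := by
  ext x
  refine ext_inner_left ℂ fun y => ?_
  simp [ContinuousLinearMap.adjoint_inner_right, PiLp.inner_apply, inner_sum,
    ContinuousLinearMap.star_eq_adjoint]

theorem adjoint_column_apply (S : J → H →L[ℂ] H) (x : PiLp 2 (fun _ : J => H)) :
    adjoint (column S) x = ∑ j, star (S j) (x j) := by
  refine ext_inner_left ℂ fun y => ?_
  simp [ContinuousLinearMap.adjoint_inner_right, PiLp.inner_apply, inner_sum,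
    ContinuousLinearMap.star_eq_adjoint]

variable {N : H →L[ℂ] H}

theorem adjoint_column_comp_column_cfc {g h : J → ℂ → ℂ}
    (hg : ∀ j, ContinuousOn (g j) (spectrum ℂ N)) (hh : ∀ j, ContinuousOn (h j) (spectrum ℂ N)) :
    adjoint (column fun j => cfc (g j) N) ∘L column (fun j => cfc (h j) N) =
      cfc (fun z => ∑ j, star (g j z) * h j z) N := by
  have h1 (j : J) : ContinuousOn (fun z => star (g j z)) (spectrum ℂ N) := (hg j).star
  rw [adjoint_column_comp_column]
  have : (fun z => ∑ j, star (g j z) * h j z) = ∑ j, fun z => star (g j z) * h j z := by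
    ext z
    simp
  rw [this, cfc_sum (fun j z => star (g j z) * h j z) _ _ fun j _ => (h1 j).mul (hh j)]
  refine Finset.sum_congr rfl fun j _ => ?_
  rw [cfc_mul _ _ _ (h1 j) (hh j), cfc_star]

theorem norm_column_cfc_le {g : J → ℂ → ℂ}
    (hg : ∀ j, ContinuousOn (g j) (spectrum ℂ N)) {B : ℝ} (hB : 0 ≤ B)
    (h : ∀ z ∈ spectrum ℂ N, ∑ j, ‖g j z‖ ^ 2 ≤ B ^ 2) :
    ‖column fun j => cfc (g j) N‖ ≤ B := by
  refine le_of_sq_le_sq ?_ hB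
  rw [sq, ← ContinuousLinearMap.norm_adjoint_comp_self, adjoint_column_comp_column_cfc hg hg]
  refine norm_cfc_le (by positivity) fun z hz => (norm_sum_le _ _).trans ?_
  simpa [sq] using h z hz

/-- The commutator estimate with an arbitrary scale `r` and discretisation parameter `ε`. -/
theorem norm_cfc_commutator_le_add {α M r ε : ℝ} (hα : 0 < α) (hα1 : α < 1) (hM : 0 ≤ M)
    (hr : 0 < r) (hε : 0 < ε) {f : ℂ → ℂ} (hf : ∀ z w, ‖f z - f w‖ ≤ M * ‖z - w‖ ^ α)
    (hfc : Continuous f) (hN : IsStarNormal N) (Q : H →L[ℂ] H) :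
    ‖cfc f N * Q - Q * cfc f N‖ ≤
      2352 * M * (r ^ α * ‖Q‖ +
        (1 - α)⁻¹ * r ^ (α - 1) * (‖N * Q - Q * N‖ + 2 * ε * ‖Q‖)) +
      2 * (M * ε ^ α) * ‖Q‖ := by
  obtain ⟨t, ψ, hψc, hψ1, hψs⟩ := exists_sq_partition (spectrum.isCompact (𝕜 := ℂ) N) hε
  have hψc' (j : t) : ContinuousOn (fun z => (ψ j z : ℂ)) (spectrum ℂ N) :=
    Complex.continuous_ofReal.comp_continuousOn (hψc j)
  set T : t → H →L[ℂ] H := fun j => cfc (fun z => (ψ j z : ℂ)) N with hT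
  set V := column T with hV
  set a : t → ℂ := fun j => (j : ℂ) with ha
  have hVV : adjoint V ∘L V = 1 := by
    rw [hV, hT, adjoint_column_comp_column_cfc hψc' hψc', ← cfc_const_one ℂ N]
    refine cfc_congr fun z hz => ?_
    have := hψ1 z hz
    simp only [Complex.star_def, Complex.conj_ofReal, ← sq]
    exact_mod_cast this
  have hVV' (x : H) : adjoint V (V x) = x := congrArg (fun S : H →L[ℂ] H => S x) hVV
  have hVn : ‖V‖ ≤ 1 := by
    refine norm_column_cfc_le hψc' zero_le_one fun z hz => ?_
    simpa using (hψ1 z hz).le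
  have hVn' : ‖adjoint V‖ ≤ 1 := by rwa [LinearIsometryEquiv.norm_map]
  have hsmall : ∀ z ∈ spectrum ℂ N, ∑ j : t, ‖((j : ℂ) - z) * ψ j z‖ ^ 2 ≤ ε ^ 2 := by
    intro z hz
    calc ∑ j : t, ‖((j : ℂ) - z) * ψ j z‖ ^ 2 ≤ ∑ j, ε ^ 2 * ψ j z ^ 2 := by
          refine Finset.sum_le_sum fun j _ => ?_
          by_cases h : ψ j z = 0
          · simp [h]
          · rw [norm_mul, mul_pow, Complex.norm_real, Real.norm_eq_abs, sq_abs]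
            gcongr
            exact hψs j z h
      _ = ε ^ 2 := by rw [← Finset.mul_sum, hψ1 z hz, mul_one]
  have hDV : ‖diagOp H a ∘L V - V ∘L N‖ ≤ ε := by
    have : diagOp H a ∘L V - V ∘L N =
        column fun j : t => cfc (fun z => ((j : ℂ) - z) * ψ j z) N := by
      ext x j
      have h1 : cfc (fun z => ((j : ℂ) - z) * ψ j z) N = a j • T j - T j * N := by
        have h2 : (fun z => ((j : ℂ) - z) * ψ j z) =
            fun z => (j : ℂ) • (ψ j z : ℂ) - ψ j z * z := by
          ext z
          simp only [smul_eq_mul]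
          ring
        rw [h2, cfc_sub (fun z => (j : ℂ) • (ψ j z : ℂ)) (fun z => ψ j z * z) _
            ((hψc' j).const_smul (j : ℂ)) ((hψc' j).mul continuousOn_id),
          cfc_smul _ (fun z => (ψ j z : ℂ)) _ (hψc' j),
          cfc_mul (fun z => (ψ j z : ℂ)) (fun z => z) _ (hψc' j) continuousOn_id, cfc_id' ℂ N]
      simp [h1, hV]
    rw [this]
    exact norm_column_cfc_le (fun j => (continuousOn_const.sub continuousOn_id).mul (hψc' j))
      hε.le hsmall
  have hVD : ‖adjoint V ∘L diagOp H a - N ∘L adjoint V‖ ≤ ε := by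
    have : adjoint V ∘L diagOp H a - N ∘L adjoint V =
        adjoint (column fun j : t => cfc (fun z => star (((j : ℂ) - z) * ψ j z)) N) := by
      ext x
      have h1 (j : t) : cfc (fun z => ((j : ℂ) - z) * ψ j z) N =
          a j • star (T j) - N * star (T j) := by
        have h2 : (fun z => ((j : ℂ) - z) * ψ j z) =
            fun z => (j : ℂ) • (ψ j z : ℂ) - z * ψ j z := by
          ext z
          simp only [smul_eq_mul]
          ring
        have h3 : star (T j) = T j := by
          rw [hT, ← cfc_star]
          simp
        rw [h3, h2, cfc_sub (fun z => (j : ℂ) • (ψ j z : ℂ)) (fun z => z * ψ j z) _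
            ((hψc' j).const_smul (j : ℂ)) (continuousOn_id.mul (hψc' j)),
          cfc_smul _ (fun z => (ψ j z : ℂ)) _ (hψc' j),
          cfc_mul (fun z => z) (fun z => (ψ j z : ℂ)) _ continuousOn_id (hψc' j), cfc_id' ℂ N]
      rw [adjoint_column_apply]
      simp_rw [cfc_star, star_star, h1]
      simp [hV, adjoint_column_apply, map_sum]
    rw [this, LinearIsometryEquiv.norm_map]
    refine norm_column_cfc_le (g := fun (j : t) z => star (((j : ℂ) - z) * ψ j z))
      (fun j => ((continuousOn_const.sub continuousOn_id).mul (hψc' j)).star) hε.le ?_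
    simpa only [norm_star] using hsmall
  set F := diagOp H (fun j => f (a j)) with hF
  have hfN : ‖cfc f N - adjoint V ∘L F ∘L V‖ ≤ M * ε ^ α := by
    have h1 : F ∘L V = column fun j : t => cfc (fun z => f j * ψ j z) N := by
      ext x j
      have : cfc (fun z => f j * ψ j z) N = f j • T j :=
        cfc_smul (f j) (fun z => (ψ j z : ℂ)) _ (hψc' j)
      simp [this, hV, hF, ha]
    have hc (j : t) : ContinuousOn (fun z => f j * ψ j z) (spectrum ℂ N) :=
      continuousOn_const.mul (hψc' j)
    have hc' : ContinuousOn (fun z => ∑ j : t, star (ψ j z : ℂ) * (f j * ψ j z))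
        (spectrum ℂ N) :=
      continuousOn_finsetSum _ fun j _ => (hψc' j).star.mul (hc j)
    rw [h1, hV, hT, adjoint_column_comp_column_cfc hψc' hc,
      ← cfc_sub _ _ _ hfc.continuousOn hc']
    refine norm_cfc_le (by positivity) fun z hz => ?_
    have h2 : f z - ∑ j : t, star (ψ j z : ℂ) * (f j * ψ j z) =
        ∑ j : t, (ψ j z : ℂ) ^ 2 * (f z - f j) := by
      have h3 : ∑ j : t, (ψ j z : ℂ) ^ 2 = 1 := by exact_mod_cast hψ1 z hz
      simp only [mul_sub, Finset.sum_sub_distrib, ← Finset.sum_mul, h3, one_mul]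
      congr 1
      refine Finset.sum_congr rfl fun j _ => ?_
      simp only [Complex.star_def, Complex.conj_ofReal]
      ring
    rw [h2]
    calc ‖∑ j : t, (ψ j z : ℂ) ^ 2 * (f z - f j)‖ ≤ ∑ j, ψ j z ^ 2 * (M * ε ^ α) := by
          refine norm_sum_le_of_le _ fun j _ => ?_
          by_cases h : ψ j z = 0
          · simp [h]
          · rw [norm_mul, norm_pow, Complex.norm_real, Real.norm_eq_abs, sq_abs]
            gcongr
            refine (hf _ _).trans ?_
            rw [norm_sub_rev]
            gcongr
            exact hψs j z h
      _ = M * ε ^ α := by rw [← Finset.sum_mul, hψ1 z hz, one_mul]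
  set Q' := V ∘L Q ∘L adjoint V with hQ'
  have hQn : ‖Q'‖ ≤ ‖Q‖ := by
    calc ‖Q'‖ ≤ ‖V‖ * (‖Q‖ * ‖adjoint V‖) := (ContinuousLinearMap.opNorm_comp_le _ _).trans
          (by gcongr; exact ContinuousLinearMap.opNorm_comp_le _ _)
      _ ≤ 1 * (‖Q‖ * 1) := by gcongr
      _ = ‖Q‖ := by ring
  have hsandwich (X : PiLp 2 (fun _ : t => H) →L[ℂ] PiLp 2 (fun _ : t => H)) :
      ‖adjoint V ∘L X ∘L V‖ ≤ ‖X‖ := by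
    calc ‖adjoint V ∘L X ∘L V‖ ≤ ‖adjoint V‖ * (‖X‖ * ‖V‖) :=
          (ContinuousLinearMap.opNorm_comp_le _ _).trans
            (by gcongr; exact ContinuousLinearMap.opNorm_comp_le _ _)
      _ ≤ 1 * (‖X‖ * 1) := by gcongr
      _ = ‖X‖ := by ring
  have hδ : ‖diagOp H a * Q' - Q' * diagOp H a‖ ≤ ‖N * Q - Q * N‖ + 2 * ε * ‖Q‖ := by
    have hdec : diagOp H a * Q' - Q' * diagOp H a =
        (diagOp H a ∘L V - V ∘L N) ∘L Q ∘L adjoint V +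
          V ∘L (N * Q - Q * N) ∘L adjoint V -
          V ∘L Q ∘L (adjoint V ∘L diagOp H a - N ∘L adjoint V) := by
      ext1 x
      simp only [hQ', ContinuousLinearMap.mul_def, sub_apply, add_apply,
        ContinuousLinearMap.comp_apply, map_sub]
      abel
    have h1 : ‖(diagOp H a ∘L V - V ∘L N) ∘L Q ∘L adjoint V‖ ≤ ε * (‖Q‖ * 1) :=
      (ContinuousLinearMap.opNorm_comp_le _ _).trans
        (by gcongr; exact (ContinuousLinearMap.opNorm_comp_le _ _).trans (by gcongr))
    have h2 : ‖V ∘L (N * Q - Q * N) ∘L adjoint V‖ ≤ 1 * (‖N * Q - Q * N‖ * 1) :=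
      (ContinuousLinearMap.opNorm_comp_le _ _).trans
        (by gcongr; exact (ContinuousLinearMap.opNorm_comp_le _ _).trans (by gcongr))
    have h3 : ‖V ∘L Q ∘L (adjoint V ∘L diagOp H a - N ∘L adjoint V)‖ ≤ 1 * (‖Q‖ * ε) :=
      (ContinuousLinearMap.opNorm_comp_le _ _).trans
        (by gcongr; exact (ContinuousLinearMap.opNorm_comp_le _ _).trans (by gcongr))
    rw [hdec]
    refine (norm_sub_le _ _).trans ((add_le_add_left (norm_add_le _ _) _).trans ?_)
    linarith
  set G := adjoint V ∘L F ∘L V with hG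
  have hGQ : G * Q - Q * G = adjoint V ∘L (F * Q' - Q' * F) ∘L V := by
    ext x
    simp [hG, hQ', hVV']
  have hmain : cfc f N * Q - Q * cfc f N =
      (cfc f N - G) * Q - Q * (cfc f N - G) + (G * Q - Q * G) := by
    simp only [sub_mul, mul_sub]
    abel
  have h1 : ‖(cfc f N - G) * Q‖ ≤ M * ε ^ α * ‖Q‖ := (norm_mul_le _ _).trans (by gcongr)
  have h2 : ‖Q * (cfc f N - G)‖ ≤ ‖Q‖ * (M * ε ^ α) := (norm_mul_le _ _).trans (by gcongr)
  have h3 : ‖G * Q - Q * G‖ ≤ 2352 * M * (r ^ α * ‖Q‖ +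
      (1 - α)⁻¹ * r ^ (α - 1) * (‖N * Q - Q * N‖ + 2 * ε * ‖Q‖)) := by
    have : 0 < 1 - α := by linarith
    rw [hGQ]
    refine (hsandwich _).trans ((norm_diagOp_commutator_le hα hα1 hM hr hf a Q').trans ?_)
    gcongr
  rw [hmain]
  refine (norm_add_le _ _).trans ?_
  have h4 := norm_sub_le ((cfc f N - G) * Q) (Q * (cfc f N - G))
  linarith

open Filter Topology in
theorem norm_cfc_commutator_le {α M r : ℝ} (hα : 0 < α) (hα1 : α < 1) (hM : 0 ≤ M)
    (hr : 0 < r) {f : ℂ → ℂ} (hf : ∀ z w, ‖f z - f w‖ ≤ M * ‖z - w‖ ^ α)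
    (hN : IsStarNormal N) (Q : H →L[ℂ] H) :
    ‖cfc f N * Q - Q * cfc f N‖ ≤
      2352 * M * (r ^ α * ‖Q‖ + (1 - α)⁻¹ * r ^ (α - 1) * ‖N * Q - Q * N‖) := by
  have hfc : Continuous f := by
    refine continuous_iff_continuousAt.2 fun w => tendsto_iff_norm_sub_tendsto_zero.2 ?_
    refine squeeze_zero (fun _ => norm_nonneg _) (fun z => hf z w) ?_
    have : ContinuousAt (fun z : ℂ => M * ‖z - w‖ ^ α) w :=
      continuousAt_const.mul (ContinuousAt.rpow_const (by fun_prop) (Or.inr hα.le))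
    simpa [ContinuousAt, Real.zero_rpow hα.ne'] using this
  have hlim : Tendsto (fun ε : ℝ => 2352 * M * (r ^ α * ‖Q‖ +
        (1 - α)⁻¹ * r ^ (α - 1) * (‖N * Q - Q * N‖ + 2 * ε * ‖Q‖)) +
      2 * (M * ε ^ α) * ‖Q‖) (𝓝[>] 0)
      (𝓝 (2352 * M * (r ^ α * ‖Q‖ + (1 - α)⁻¹ * r ^ (α - 1) * ‖N * Q - Q * N‖))) := by
    have : Continuous fun ε : ℝ => 2352 * M * (r ^ α * ‖Q‖ +
        (1 - α)⁻¹ * r ^ (α - 1) * (‖N * Q - Q * N‖ + 2 * ε * ‖Q‖)) +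
        2 * (M * ε ^ α) * ‖Q‖ := by
      have := Real.continuous_rpow_const hα.le
      fun_prop
    have h0 := this.tendsto 0
    simp only [Real.zero_rpow hα.ne', mul_zero, zero_mul, add_zero] at h0
    exact h0.mono_left nhdsWithin_le_nhds
  refine ge_of_tendsto hlim ?_
  filter_upwards [self_mem_nhdsWithin] with ε hε
  exact norm_cfc_commutator_le_add hα hα1 hM hr hε hf hfc hN Q

open Filter Topology in
/-- Optimising `norm_cfc_commutator_le` over the scale. -/
theorem norm_cfc_commutator_le_rpow {α M δ : ℝ} (hα : 0 < α) (hα1 : α < 1) (hM : 0 ≤ M)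
    {f : ℂ → ℂ} (hf : ∀ z w, ‖f z - f w‖ ≤ M * ‖z - w‖ ^ α) (hN : IsStarNormal N)
    (Q : H →L[ℂ] H) (hδ : ‖N * Q - Q * N‖ ≤ δ) :
    ‖cfc f N * Q - Q * cfc f N‖ ≤ 4704 * (1 - α)⁻¹ * M * ‖Q‖ ^ (1 - α) * δ ^ α := by
  have hα' : 0 < 1 - α := by linarith
  rcases (norm_nonneg Q).eq_or_lt with hQ | hQ
  · rw [eq_comm, norm_eq_zero] at hQ
    simp [hQ, Real.zero_rpow hα'.ne']
  have hδ0 : 0 ≤ δ := (norm_nonneg _).trans hδ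
  have hlim : Tendsto (fun d : ℝ => 4704 * (1 - α)⁻¹ * M * ‖Q‖ ^ (1 - α) * d ^ α) (𝓝[>] δ)
      (𝓝 (4704 * (1 - α)⁻¹ * M * ‖Q‖ ^ (1 - α) * δ ^ α)) :=
    (((Real.continuous_rpow_const hα.le).const_mul _).tendsto δ).mono_left nhdsWithin_le_nhds
  refine ge_of_tendsto hlim ?_
  filter_upwards [self_mem_nhdsWithin] with d hd
  have hd0 : 0 < d := hδ0.trans_lt hd
  have hr : 0 < d / ‖Q‖ := by positivity
  refine (norm_cfc_commutator_le hα hα1 hM hr hf hN Q).trans ?_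
  have h1 : (d / ‖Q‖) ^ α * ‖Q‖ = ‖Q‖ ^ (1 - α) * d ^ α := by
    rw [Real.div_rpow hd0.le hQ.le, Real.rpow_sub hQ, Real.rpow_one]
    ring
  have h2 : (d / ‖Q‖) ^ (α - 1) * d = ‖Q‖ ^ (1 - α) * d ^ α := by
    rw [← h1, Real.rpow_sub_one hr.ne']
    field_simp
  have h3 : 1 ≤ (1 - α)⁻¹ := (one_le_inv₀ hα').2 (by linarith)
  calc 2352 * M * ((d / ‖Q‖) ^ α * ‖Q‖ + (1 - α)⁻¹ * (d / ‖Q‖) ^ (α - 1) * ‖N * Q - Q * N‖)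
      ≤ 2352 * M * ((1 - α)⁻¹ * ((d / ‖Q‖) ^ α * ‖Q‖) +
          (1 - α)⁻¹ * (d / ‖Q‖) ^ (α - 1) * d) := by
        refine mul_le_mul_of_nonneg_left (add_le_add ?_ ?_) (by positivity)
        · exact le_mul_of_one_le_left (by positivity) h3
        · exact mul_le_mul_of_nonneg_left (hδ.trans (le_of_lt hd)) (by positivity)
    _ = 2352 * M * (1 - α)⁻¹ * ((d / ‖Q‖) ^ α * ‖Q‖ + (d / ‖Q‖) ^ (α - 1) * d) := by ring
    _ = 4704 * (1 - α)⁻¹ * M * ‖Q‖ ^ (1 - α) * d ^ α := by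
        rw [h1, h2]
        ring

end Dilation

end HolderCommutator

/-- Commutator Hölder estimate: there is an absolute constant `c > 0` such that for every
`α ∈ (0,1)`, every `f ∈ Λ_α(ℝ²)` with Hölder bound `M` (so `‖f‖_{Λ_α} ≤ M`), every bounded
normal operator `N` and every bounded operator `Q`,
`‖f(N)Q - Q f(N)‖ ≤ c (1-α)⁻¹ M ‖Q‖^{1-α} (max{‖NQ - QN‖, ‖N*Q - QN*‖})^α`. -/
theorem holder_commutator :
    ∃ c : ℝ, 0 < c ∧
      ∀ (α : ℝ), 0 < α → α < 1 →
      ∀ (f : ℂ → ℂ) (M : ℝ), 0 ≤ M →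
      (∀ z₁ z₂ : ℂ, ‖f z₁ - f z₂‖ ≤ M * ‖z₁ - z₂‖ ^ α) →
      ∀ (H : Type*) [NormedAddCommGroup H] [InnerProductSpace ℂ H] [CompleteSpace H]
        (N : H →L[ℂ] H), IsStarNormal N →
        ∀ Q : H →L[ℂ] H,
        ‖cfc f N * Q - Q * cfc f N‖ ≤
          c * (1 - α)⁻¹ * M * ‖Q‖ ^ (1 - α) *
            max ‖N * Q - Q * N‖ ‖star N * Q - Q * star N‖ ^ α := by
  refine ⟨4704, by norm_num, fun α hα hα1 f M hM hf H _ _ _ N hN Q => ?_⟩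
  exact HolderCommutator.norm_cfc_commutator_le_rpow hα hα1 hM hf hN Q (le_max_left _ _)
end
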